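/- There is a constant C₁ depending only on the dimension N such that for every M > 0, every open set Ω ⊆ ℝ^N, every z ∈ ℝ^N, and every u ∈ P₁(z,M), the gradient ∇u is Lipschitz on B(z,1/2) with Lipschitz constant at most C₁·M (i.e. u has a uniform interior C^{1,1} bound: |D²u| ≤ C₁·M on B(z,1/2)). -/

import Mathlib

open MeasureTheory Metric Set Filter
open scoped RealInnerProductSpace

noncomputable section

/-- The Laplacian of `φ` at `x`, as the sum of the pure second derivatives. -/
def lap (N : ℕ) (φ : EuclideanSpace ℝ (Fin N) → ℝ) (x : EuclideanSpace ℝ (Fin N)) : ℝ :=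
  ∑ i : Fin N,
    fderiv ℝ (fun y => fderiv ℝ φ y (EuclideanSpace.single i 1)) x (EuclideanSpace.single i 1)

/-- Membership in the class `P_r(z, M)`. -/
def MemP (N : ℕ) (r : ℝ) (z : EuclideanSpace ℝ (Fin N)) (M : ℝ)
    (Ω : Set (EuclideanSpace ℝ (Fin N))) (u : EuclideanSpace ℝ (Fin N) → ℝ) : Prop :=
  IsOpen Ω ∧ ContDiff ℝ 1 u ∧
    (∀ φ : EuclideanSpace ℝ (Fin N) → ℝ, ContDiff ℝ (⊤ : ℕ∞) φ → tsupport φ ⊆ ball z r →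
      ∫ x, u x * lap N φ x = ∫ x in Ω, φ x) ∧
    (∀ x ∈ ball z r \ Ω, u x = 0 ∧ gradient u x = 0) ∧
    (∀ x ∈ ball z r, |u x| ≤ M) ∧
    z ∈ frontier Ω

/-- Membership in the class `P_∞(0, M)` of global solutions with quadratic growth. -/
def MemPinf (N : ℕ) (M : ℝ) (Ω : Set (EuclideanSpace ℝ (Fin N)))
    (u : EuclideanSpace ℝ (Fin N) → ℝ) : Prop :=
  IsOpen Ω ∧ ContDiff ℝ 1 u ∧
    (∀ φ : EuclideanSpace ℝ (Fin N) → ℝ, ContDiff ℝ (⊤ : ℕ∞) φ → HasCompactSupport φ →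
      ∫ x, u x * lap N φ x = ∫ x in Ω, φ x) ∧
    (∀ x ∈ Ωᶜ, u x = 0 ∧ gradient u x = 0) ∧
    (0 : EuclideanSpace ℝ (Fin N)) ∈ frontier Ω ∧
    (∀ x, |u x| ≤ M * (‖x‖ ^ 2 + 1))

/-- The minimum diameter of a set: the smallest width of a slab containing it. -/
def MD (N : ℕ) (D : Set (EuclideanSpace ℝ (Fin N))) : ℝ :=
  ⨅ e : {e : EuclideanSpace ℝ (Fin N) // ‖e‖ = 1},
    ((⨆ x : D, ⟪(x : EuclideanSpace ℝ (Fin N)), (e : EuclideanSpace ℝ (Fin N))⟫) -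
      ⨅ x : D, ⟪(x : EuclideanSpace ℝ (Fin N)), (e : EuclideanSpace ℝ (Fin N))⟫)

/-- The density function `δ_r(u)`. -/
def deltaFn (N : ℕ) (u : EuclideanSpace ℝ (Fin N) → ℝ) (r : ℝ) : ℝ :=
  MD N ({x | u x = 0 ∧ gradient u x = 0} ∩ ball 0 r) / r

/-- Half-space solutions `x ↦ (max(⟪x,e⟫,0))²/2`. -/
def IsHalfSpaceSol (N : ℕ) (u : EuclideanSpace ℝ (Fin N) → ℝ) : Prop :=
  ∃ e : EuclideanSpace ℝ (Fin N), ‖e‖ = 1 ∧ ∀ x, u x = (max ⟪x, e⟫ 0) ^ 2 / 2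

/-- `∂Ω ∩ B` is the graph of a `C¹` function. -/
def IsC1Graph (N : ℕ) (Ω B : Set (EuclideanSpace ℝ (Fin N))) : Prop :=
  ∃ (e : EuclideanSpace ℝ (Fin N)) (f : EuclideanSpace ℝ (Fin N) → ℝ),
    ‖e‖ = 1 ∧ ContDiff ℝ 1 f ∧
    Ω ∩ B = {x ∈ B | f (x - ⟪x, e⟫ • e) < ⟪x, e⟫} ∧
    frontier Ω ∩ B = {x ∈ B | ⟪x, e⟫ = f (x - ⟪x, e⟫ • e)}

/-- `∂Ω ∩ B` is the graph of a real-analytic function. -/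
def IsAnalyticGraph (N : ℕ) (Ω B : Set (EuclideanSpace ℝ (Fin N))) : Prop :=
  ∃ (e : EuclideanSpace ℝ (Fin N)) (f : EuclideanSpace ℝ (Fin N) → ℝ),
    ‖e‖ = 1 ∧ (∀ x, AnalyticAt ℝ f x) ∧
    Ω ∩ B = {x ∈ B | f (x - ⟪x, e⟫ • e) < ⟪x, e⟫} ∧
    frontier Ω ∩ B = {x ∈ B | ⟪x, e⟫ = f (x - ⟪x, e⟫ • e)}

/-- The Alt–Caffarelli–Friedman functional `φ(r, v)` centered at the origin. -/
def acf (N : ℕ) (v : EuclideanSpace ℝ (Fin N) → ℝ) (r : ℝ) : ℝ :=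
  r ^ (-4 : ℤ) *
    (∫ x in ball (0 : EuclideanSpace ℝ (Fin N)) r,
      ‖gradient (fun y => max (v y) 0) x‖ ^ 2 * ‖x‖ ^ ((2 : ℤ) - (N : ℤ))) *
    ∫ x in ball (0 : EuclideanSpace ℝ (Fin N)) r,
      ‖gradient (fun y => max (-v y) 0) x‖ ^ 2 * ‖x‖ ^ ((2 : ℤ) - (N : ℤ))

/-- `S_j(z, u) = sup_{B(z, 2^{-j})} |u|`. -/
def Sj (N : ℕ) (z : EuclideanSpace ℝ (Fin N)) (u : EuclideanSpace ℝ (Fin N) → ℝ) (j : ℕ) : ℝ :=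
  sSup ((fun x => |u x|) '' ball z ((2 : ℝ) ^ (-(j : ℤ))))

/-- A power times a smooth function vanishing to the left of `1/4` is smooth. -/
theorem contDiff_rpow_mul_of_vanishing {Q : ℝ → ℝ} (hQ : ContDiff ℝ (⊤ : ℕ∞) Q)
    (h0 : ∀ t < 1 / 4, Q t = 0) (a : ℝ) : ContDiff ℝ (⊤ : ℕ∞) (fun t => t ^ a * Q t) := by
  rw [contDiff_iff_contDiffAt]
  intro t
  rcases lt_or_ge t (1 / 4) with ht | ht
  · refine (contDiffAt_const (c := (0 : ℝ))).congr_of_eventuallyEq ?_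
    filter_upwards [Iio_mem_nhds ht] with s hs
    simp [h0 s hs]
  · exact (Real.contDiffAt_rpow_const_of_ne (by linarith)).mul hQ.contDiffAt

/-- One-dimensional profiles of the radial kernels used for mollification. -/
theorem exists_radial_profile (α : ℝ) : ∃ h k k' p : ℝ → ℝ,
    ContDiff ℝ (⊤ : ℕ∞) h ∧ ContDiff ℝ (⊤ : ℕ∞) p ∧
    (∀ t, HasDerivAt h (k t) t) ∧ (∀ t, HasDerivAt k (k' t) t) ∧
    (∀ t, 4 * t * k' t + 4 * α * k t = (4 : ℝ) ^ (-α) * p (t / 4) - p t) ∧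
    (∀ t, 0 ≤ h t) ∧ (∀ t, 0 ≤ p t) ∧ 0 < h 0 ∧ (∃ t > 0, p t ≠ 0) ∧
    (∀ t ≥ 2, h t = 0) ∧ (∀ t ≥ 2, p t = 0) := by
  set P : ℝ → ℝ := fun t => Real.smoothTransition (4 * t - 1) with hP
  have hPs : ContDiff ℝ (⊤ : ℕ∞) P :=
    Real.smoothTransition.contDiff.comp ((contDiff_const.mul contDiff_id).sub contDiff_const)
  have hP0 : ∀ t ≤ 1 / 4, P t = 0 := fun t ht =>
    Real.smoothTransition.zero_of_nonpos (by linarith)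
  have hP1 : ∀ t ≥ 1 / 2, P t = 1 := fun t ht =>
    Real.smoothTransition.one_of_one_le (by linarith)
  have hPm : Monotone P := fun a b hab => Real.smoothTransition.monotone (by linarith)
  have hPd : ∀ t, HasDerivAt P (deriv P t) t := fun t =>
    (hPs.differentiable (by simp) t).hasDerivAt
  have hdPs : ContDiff ℝ (⊤ : ℕ∞) (deriv P) := (contDiff_infty_iff_deriv.1 hPs).2
  have hdP0 : ∀ t < 1 / 4, deriv P t = 0 := by
    intro t ht
    have : P =ᶠ[nhds t] fun _ => (0 : ℝ) := by
      filter_upwards [Iio_mem_nhds ht] with s hs using hP0 s (le_of_lt hs)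
    rw [this.deriv_eq, deriv_const]
  have hdP1 : ∀ t > 1 / 2, deriv P t = 0 := by
    intro t ht
    have : P =ᶠ[nhds t] fun _ => (1 : ℝ) := by
      filter_upwards [Ioi_mem_nhds ht] with s hs using hP1 s (le_of_lt hs)
    rw [this.deriv_eq, deriv_const]
  set q : ℝ → ℝ := fun t => (P (t / 4) - P t) / 4 with hq
  have hqs : ContDiff ℝ (⊤ : ℕ∞) q :=
    ((hPs.comp (contDiff_id.div_const 4)).sub hPs).div_const 4
  have hq0 : ∀ t < 1 / 4, q t = 0 := by
    intro t ht
    rcases le_or_gt 0 t with h | h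
    · simp only [hq]; rw [hP0 t ht.le, hP0 (t / 4) (by linarith)]; simp
    · simp only [hq]; rw [hP0 t ht.le, hP0 (t / 4) (by linarith)]; simp
  have hq2 : ∀ t ≥ 2, q t = 0 := by
    intro t ht
    simp only [hq]; rw [hP1 t (by linarith), hP1 (t / 4) (by linarith)]; simp
  have hqle : ∀ t, 0 ≤ t → q t ≤ 0 := by
    intro t ht
    have := hPm (show t / 4 ≤ t by linarith)
    simp only [hq]; linarith
  set k : ℝ → ℝ := fun t => t ^ (-α) * q t with hk
  have hks : ContDiff ℝ (⊤ : ℕ∞) k := contDiff_rpow_mul_of_vanishing hqs hq0 _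
  have hkle : ∀ t, k t ≤ 0 := by
    intro t
    rcases le_or_gt 0 t with h | h
    · exact mul_nonpos_of_nonneg_of_nonpos (Real.rpow_nonneg h _) (hqle t h)
    · simp [hk, hq0 t (by linarith)]
  set p : ℝ → ℝ := fun t => t ^ (1 - α) * deriv P t with hp
  have hps : ContDiff ℝ (⊤ : ℕ∞) p := contDiff_rpow_mul_of_vanishing hdPs hdP0 _
  set h : ℝ → ℝ := fun t => ∫ s in (2 : ℝ)..t, k s with hh
  have hhd : ∀ t, HasDerivAt h (k t) t := fun t =>
    intervalIntegral.integral_hasDerivAt_right (hks.continuous.intervalIntegrable _ _)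
      hks.continuous.stronglyMeasurable.stronglyMeasurableAtFilter hks.continuous.continuousAt
  have hhs : ContDiff ℝ (⊤ : ℕ∞) h := by
    rw [contDiff_infty_iff_deriv]
    refine ⟨fun t => (hhd t).differentiableAt, ?_⟩
    rwa [show deriv h = k from funext fun t => (hhd t).deriv]
  have hh_anti : Antitone h := antitone_of_deriv_nonpos (fun t => (hhd t).differentiableAt)
    (fun t => by rw [(hhd t).deriv]; exact hkle t)
  have hh2 : ∀ t ≥ 2, h t = 0 := by
    intro t ht
    simp only [hh]
    rw [intervalIntegral.integral_congr (g := fun _ => (0 : ℝ))]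
    · simp
    · intro s hs
      rw [uIcc_of_le ht] at hs
      simp [hk, hq2 s hs.1]
  have hh0 : ∀ t, 0 ≤ h t := by
    intro t
    rw [← hh2 (max t 2) (le_max_right _ _)]
    exact hh_anti (le_max_left _ _)
  refine ⟨h, k, deriv k, p, hhs, hps, hhd, fun t => (hks.differentiable (by simp) t).hasDerivAt,
    ?_, hh0, ?_, ?_, ?_, hh2, ?_⟩
  · intro t
    rcases lt_or_ge t (1 / 4) with ht | ht
    · have h1 : k =ᶠ[nhds t] fun _ => (0 : ℝ) := by
        filter_upwards [Iio_mem_nhds ht] with s hs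
        simp [hk, hq0 s hs]
      have h2 : t / 4 < 1 / 4 := by linarith
      rw [h1.deriv_eq, h1.eq_of_nhds]
      simp [hp, hdP0 t ht, hdP0 _ h2]
    · have ht0 : 0 < t := by linarith
      have e1 : HasDerivAt (fun t : ℝ => t ^ (-α)) (-α * t ^ (-α - 1)) t :=
        Real.hasDerivAt_rpow_const (Or.inl ht0.ne')
      have e0 : HasDerivAt (fun t => P (t / 4)) (deriv P (t / 4) * (1 / 4)) t :=
        HasDerivAt.comp (h₂ := P) (h := fun s : ℝ => s / 4) t (hPd (t / 4))
          ((hasDerivAt_id t).div_const 4)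
      have e2 : HasDerivAt q ((deriv P (t / 4) * (1 / 4) - deriv P t) / 4) t :=
        (e0.sub (hPd t)).div_const 4
      have e3 := (e1.mul e2).deriv
      have e4 : deriv k t = deriv ((fun t : ℝ => t ^ (-α)) * q) t := rfl
      rw [e4, e3]
      have e5 : t ^ (1 - α) = t * t ^ (-α) := by
        rw [show 1 - α = -α + 1 by ring, Real.rpow_add_one ht0.ne']; ring
      have e6 : t * t ^ (-α - 1) = t ^ (-α) := by
        rw [show -α = (-α - 1) + 1 by ring, Real.rpow_add_one ht0.ne']; ring_nf
      have e7 : (4 : ℝ) ^ (-α) * (t / 4) ^ (1 - α) = t ^ (1 - α) * (1 / 4) := by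
        rw [Real.div_rpow ht0.le (by norm_num), show (1 - α) = -α + 1 by ring,
          Real.rpow_add_one (show (4 : ℝ) ≠ 0 by norm_num)]
        have : (4 : ℝ) ^ (-α) ≠ 0 := (Real.rpow_pos_of_pos (by norm_num) _).ne'
        field_simp
      simp only [hp, hk]
      rw [← mul_assoc ((4 : ℝ) ^ (-α)), e7, e5]
      linear_combination (-4 * α * q t) * e6
  · intro t
    rcases le_or_gt 0 t with h | h
    · exact mul_nonneg (Real.rpow_nonneg h _) hPm.deriv_nonneg
    · simp [hp, hdP0 t (by linarith)]
  · refine lt_of_le_of_ne (hh0 0) fun h00 => ?_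
    have hz : ∀ t ∈ Ioi (0 : ℝ), h t = 0 := fun t ht =>
      le_antisymm (by rw [h00]; exact hh_anti (le_of_lt ht)) (hh0 t)
    have hz' : h =ᶠ[nhds 1] fun _ => (0 : ℝ) := by
      filter_upwards [Ioi_mem_nhds (show (0 : ℝ) < 1 by norm_num)] with s hs using hz s hs
    have : k 1 = 0 := by rw [← (hhd 1).deriv, hz'.deriv_eq, deriv_const]
    simp only [hk, hq, Real.one_rpow] at this
    rw [hP0 (1 / 4) le_rfl, hP1 1 (by norm_num)] at this
    norm_num at this
  · by_contra! hcon
    have : ∀ t, deriv P t = 0 := by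
      intro t
      rcases lt_or_ge t (1 / 4) with ht | ht
      · exact hdP0 t ht
      · have ht0 : 0 < t := by linarith
        have := hcon t ht0
        simp only [hp, mul_eq_zero] at this
        exact this.resolve_left (Real.rpow_pos_of_pos ht0 _).ne'
    have := is_const_of_deriv_eq_zero (hPs.differentiable (by simp)) this 0 1
    rw [hP0 0 (by norm_num), hP1 1 (by norm_num)] at this
    norm_num at this
  · intro t ht
    simp [hp, hdP1 t (by linarith)]

/-- The Laplacian of a radial function. -/
theorem lap_radial {N : ℕ} {h k k' : ℝ → ℝ} (hk : ∀ t, HasDerivAt h (k t) t)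
    (hk' : ∀ t, HasDerivAt k (k' t) t) (x : EuclideanSpace ℝ (Fin N)) :
    lap N (fun y => h (‖y‖ ^ 2)) x = 4 * ‖x‖ ^ 2 * k' (‖x‖ ^ 2) + 2 * N * k (‖x‖ ^ 2) := by
  have hn : ∀ y : EuclideanSpace ℝ (Fin N),
      HasFDerivAt (fun y : EuclideanSpace ℝ (Fin N) => ‖y‖ ^ 2) (2 • innerSL ℝ y) y :=
    fun y => (hasStrictFDerivAt_norm_sq y).hasFDerivAt
  have h1 : ∀ (i : Fin N), (fun y : EuclideanSpace ℝ (Fin N) =>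
      fderiv ℝ (fun y => h (‖y‖ ^ 2)) y (EuclideanSpace.single i 1)) =
      fun y => k (‖y‖ ^ 2) * (2 * ⟪y, EuclideanSpace.single i 1⟫) := by
    intro i
    funext y
    have := ((hk (‖y‖ ^ 2)).comp_hasFDerivAt y (hn y)).fderiv
    rw [show (fun y : EuclideanSpace ℝ (Fin N) => h (‖y‖ ^ 2)) =
      h ∘ (fun y : EuclideanSpace ℝ (Fin N) => ‖y‖ ^ 2) from rfl, this]
    simp
  have h2 : ∀ (i : Fin N), fderiv ℝ (fun y : EuclideanSpace ℝ (Fin N) =>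
      k (‖y‖ ^ 2) * (2 * ⟪y, EuclideanSpace.single i 1⟫)) x (EuclideanSpace.single i 1) =
      4 * k' (‖x‖ ^ 2) * (x i) ^ 2 + 2 * k (‖x‖ ^ 2) := by
    intro i
    have e1 : HasFDerivAt (fun y : EuclideanSpace ℝ (Fin N) => k (‖y‖ ^ 2)) _ x :=
      (hk' (‖x‖ ^ 2)).comp_hasFDerivAt x (hn x)
    have e2 : HasFDerivAt (fun y : EuclideanSpace ℝ (Fin N) =>
        2 * ⟪y, EuclideanSpace.single i (1 : ℝ)⟫)
        ((2 : ℝ) • innerSL ℝ (EuclideanSpace.single i (1 : ℝ))) x := by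
      have := ((innerSL ℝ (EuclideanSpace.single i (1 : ℝ))).hasFDerivAt (x := x)).const_mul (2 : ℝ)
      simpa [real_inner_comm] using this
    rw [(e1.fun_mul e2).fderiv]
    simp [EuclideanSpace.inner_single_right]
    ring
  unfold lap
  simp_rw [h1, h2, Finset.sum_add_distrib, ← Finset.mul_sum]
  rw [EuclideanSpace.real_norm_sq_eq]
  simp
  ring

/-- A mollifier `φ` together with a potential `Ψ` solving `ΔΨ = φ₂ - φ`, where
`φ₂ = 2⁻ᴺ φ(·/2)`. -/
structure DyadicKernel (N : ℕ) where
  φ : EuclideanSpace ℝ (Fin N) → ℝ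
  Ψ : EuclideanSpace ℝ (Fin N) → ℝ
  φ_smooth : ContDiff ℝ (⊤ : ℕ∞) φ
  Ψ_smooth : ContDiff ℝ (⊤ : ℕ∞) Ψ
  φ_supp : tsupport φ ⊆ ball 0 2
  Ψ_supp : tsupport Ψ ⊆ ball 0 2
  φ_nonneg : ∀ x, 0 ≤ φ x
  Ψ_nonneg : ∀ x, 0 ≤ Ψ x
  φ_even : ∀ x, φ (-x) = φ x
  integral_φ : ∫ x, φ x = 1
  Ψ_pos : 0 < Ψ 0
  lap_Ψ : ∀ x, lap N Ψ x = ((2 : ℝ) ^ N)⁻¹ * φ ((2 : ℝ)⁻¹ • x) - φ x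

theorem tsupport_radial_subset {N : ℕ} {h : ℝ → ℝ} (h2 : ∀ t ≥ 2, h t = 0) :
    tsupport (fun x : EuclideanSpace ℝ (Fin N) => h (‖x‖ ^ 2)) ⊆ ball 0 2 := by
  have h1 : tsupport (fun x : EuclideanSpace ℝ (Fin N) => h (‖x‖ ^ 2)) ⊆ closedBall 0 (3 / 2) := by
    refine closure_minimal ?_ isClosed_closedBall
    intro x hx
    rw [mem_closedBall_zero_iff]
    by_contra! hlt
    exact hx (h2 _ (by nlinarith))
  exact h1.trans (closedBall_subset_ball (by norm_num))

theorem lap_mul_const {N : ℕ} (f : EuclideanSpace ℝ (Fin N) → ℝ) (c : ℝ)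
    (hf : ContDiff ℝ (⊤ : ℕ∞) f) (x : EuclideanSpace ℝ (Fin N)) :
    lap N (fun y => c * f y) x = c * lap N f x := by
  have h1 : ∀ i : Fin N, (fun y => fderiv ℝ (fun y => c * f y) y (EuclideanSpace.single i 1)) =
      fun y => c * fderiv ℝ f y (EuclideanSpace.single i 1) := by
    intro i; funext y
    rw [fderiv_const_mul (hf.differentiable (by simp) y)]
    simp
  unfold lap
  simp_rw [h1]
  rw [Finset.mul_sum]
  refine Finset.sum_congr rfl fun i _ => ?_
  rw [fderiv_const_mul]
  · simp
  · exact (((hf.fderiv_right (m := (⊤ : ℕ∞)) (by simp)).clm_apply contDiff_const).differentiable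
      (by simp)) x

theorem nonempty_dyadicKernel (N : ℕ) (hN : 1 ≤ N) : Nonempty (DyadicKernel N) := by
  obtain ⟨h, k, k', p, hhs, hps, hk, hk', hrel, hh0, hp0, hh00, ⟨t, ht, hpt⟩, hh2, hp2⟩ :=
    exists_radial_profile (N / 2)
  have hns : ContDiff ℝ (⊤ : ℕ∞) (fun x : EuclideanSpace ℝ (Fin N) => ‖x‖ ^ 2) :=
    contDiff_norm_sq ℝ
  have hφs : ContDiff ℝ (⊤ : ℕ∞) (fun x : EuclideanSpace ℝ (Fin N) => p (‖x‖ ^ 2)) :=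
    hps.comp hns
  have hΨs : ContDiff ℝ (⊤ : ℕ∞) (fun x : EuclideanSpace ℝ (Fin N) => h (‖x‖ ^ 2)) :=
    hhs.comp hns
  have hφc : HasCompactSupport (fun x : EuclideanSpace ℝ (Fin N) => p (‖x‖ ^ 2)) :=
    (isCompact_closedBall 0 2).of_isClosed_subset (isClosed_tsupport _)
      ((tsupport_radial_subset hp2).trans ball_subset_closedBall)
  set I := ∫ x : EuclideanSpace ℝ (Fin N), p (‖x‖ ^ 2) with hI
  have hIpos : 0 < I := by
    refine Continuous.integral_pos_of_hasCompactSupport_nonneg_nonzero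
      (x := EuclideanSpace.single ⟨0, hN⟩ (Real.sqrt t)) hφs.continuous hφc
      (fun x => hp0 _) ?_
    simpa [Real.sq_sqrt ht.le] using hpt
  refine ⟨⟨fun x => I⁻¹ * p (‖x‖ ^ 2), fun x => I⁻¹ * h (‖x‖ ^ 2), contDiff_const.mul hφs,
    contDiff_const.mul hΨs, ?_, ?_, ?_, ?_, ?_, ?_, ?_, ?_⟩⟩
  · exact tsupport_radial_subset (h := fun t => I⁻¹ * p t) (by intro t ht; simp [hp2 t ht])
  · exact tsupport_radial_subset (h := fun t => I⁻¹ * h t) (by intro t ht; simp [hh2 t ht])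
  · intro x; exact mul_nonneg (inv_nonneg.2 hIpos.le) (hp0 _)
  · intro x; exact mul_nonneg (inv_nonneg.2 hIpos.le) (hh0 _)
  · intro x; simp
  · rw [integral_const_mul, inv_mul_cancel₀ hIpos.ne']
  · simpa using mul_pos (inv_pos.2 hIpos) hh00
  · intro x
    rw [lap_mul_const _ _ hΨs, lap_radial hk hk']
    have := hrel (‖x‖ ^ 2)
    have e1 : (4 : ℝ) ^ (-((N : ℝ) / 2)) = ((2 : ℝ) ^ N)⁻¹ := by
      rw [Real.rpow_neg (by norm_num), show (4 : ℝ) = 2 ^ (2 : ℝ) by norm_num,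
        ← Real.rpow_mul (by norm_num), mul_div_cancel₀ _ (by norm_num), Real.rpow_natCast]
    have e2 : ‖(2 : ℝ)⁻¹ • x‖ ^ 2 = ‖x‖ ^ 2 / 4 := by
      rw [norm_smul, mul_pow]; norm_num; ring
    rw [e1] at this
    simp only [e2]
    linear_combination I⁻¹ * this

section Avg

variable {N : ℕ} {F : Type*} [NormedAddCommGroup F]

theorem hasCompactSupport_of_tsupport_subset {κ : EuclideanSpace ℝ (Fin N) → F}
    (hs : tsupport κ ⊆ ball 0 2) : HasCompactSupport κ :=
  (isCompact_closedBall 0 2).of_isClosed_subset (isClosed_tsupport _)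
    (hs.trans ball_subset_closedBall)

theorem kernel_eq_zero {κ : EuclideanSpace ℝ (Fin N) → F} (hs : tsupport κ ⊆ ball 0 2) {r : ℝ}
    (hr : 0 < r) {x y : EuclideanSpace ℝ (Fin N)} (hy : y ∉ ball x (2 * r)) :
    κ (r⁻¹ • (x - y)) = 0 := by
  by_contra h
  have h1 := hs (subset_tsupport κ h)
  rw [mem_ball_zero_iff, norm_smul, norm_inv, Real.norm_of_nonneg hr.le, inv_mul_lt_iff₀ hr,
    ← dist_eq_norm, dist_comm] at h1
  exact hy (by rw [mem_ball]; linarith)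

theorem hasCompactSupport_rescale {κ : EuclideanSpace ℝ (Fin N) → F}
    (hs : tsupport κ ⊆ ball 0 2) {r : ℝ} (hr : 0 < r) (x : EuclideanSpace ℝ (Fin N)) :
    HasCompactSupport (fun y => κ (r⁻¹ • (x - y))) :=
  HasCompactSupport.intro (isCompact_closedBall x (2 * r)) fun _ hy =>
    kernel_eq_zero hs hr fun h => hy (ball_subset_closedBall h)

variable [NormedSpace ℝ F]

/-- The average of `w` around `x` at scale `r`, with weight `κ`. -/
def avg (w : EuclideanSpace ℝ (Fin N) → ℝ) (κ : EuclideanSpace ℝ (Fin N) → F) (r : ℝ)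
    (x : EuclideanSpace ℝ (Fin N)) : F :=
  (r ^ N)⁻¹ • ∫ y, w y • κ (r⁻¹ • (x - y))

theorem integrable_avg {w : EuclideanSpace ℝ (Fin N) → ℝ} (hw : LocallyIntegrable w)
    {κ : EuclideanSpace ℝ (Fin N) → F} (hκ : Continuous κ) (hs : tsupport κ ⊆ ball 0 2) {r : ℝ}
    (hr : 0 < r) (x : EuclideanSpace ℝ (Fin N)) :
    Integrable (fun y => w y • κ (r⁻¹ • (x - y))) :=
  hw.integrable_smul_right_of_hasCompactSupport (by fun_prop) (hasCompactSupport_rescale hs hr x)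

theorem hasFDerivAt_avg {w : EuclideanSpace ℝ (Fin N) → ℝ} (hw : LocallyIntegrable w)
    {κ : EuclideanSpace ℝ (Fin N) → F} (hκ : ContDiff ℝ 1 κ) (hs : tsupport κ ⊆ ball 0 2) {r : ℝ}
    (hr : 0 < r) (x : EuclideanSpace ℝ (Fin N)) :
    HasFDerivAt (avg w κ r) (r⁻¹ • avg w (fderiv ℝ κ) r x) x := by
  set g : EuclideanSpace ℝ (Fin N) → F := fun y => κ (r⁻¹ • y) with hg
  have hgc : HasCompactSupport g := by
    have := hasCompactSupport_rescale hs hr (0 : EuclideanSpace ℝ (Fin N))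
    have h2 := this.comp_homeomorph (Homeomorph.neg (EuclideanSpace ℝ (Fin N)))
    simpa [Function.comp_def] using h2
  have hg1 : ContDiff ℝ 1 g := hκ.comp (contDiff_const_smul _)
  have hgd : ∀ y, fderiv ℝ g y = r⁻¹ • fderiv ℝ κ (r⁻¹ • y) := by
    intro y
    exact fderiv_comp_smul r⁻¹
  have h := hgc.hasFDerivAt_convolution_right (ContinuousLinearMap.lsmul ℝ ℝ) hw hg1 x
  have h' := h.const_smul (r ^ N)⁻¹
  have e1 : (fun x => (r ^ N)⁻¹ • (convolution w g (ContinuousLinearMap.lsmul ℝ ℝ) volume) x) =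
      avg w κ r := by
    funext y
    simp [avg, convolution, hg]
  have e2 : (r ^ N)⁻¹ • (convolution w (fderiv ℝ g)
      ((ContinuousLinearMap.lsmul ℝ ℝ).precompR (EuclideanSpace ℝ (Fin N))) volume) x =
      r⁻¹ • avg w (fderiv ℝ κ) r x := by
    rw [avg, smul_comm r⁻¹, ← integral_smul, convolution]
    congr 2
    funext y
    rw [hgd]
    ext v
    exact smul_comm (w y) r⁻¹ (fderiv ℝ κ (r⁻¹ • (x - y)) v)
  rw [← e2, ← e1]
  exact h'

theorem norm_integral_le_of_le_indicator {f : EuclideanSpace ℝ (Fin N) → F}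
    {S : Set (EuclideanSpace ℝ (Fin N))} (hS : MeasurableSet S) (hfin : volume S ≠ ⊤) {c : ℝ}
    (hf : ∀ y, ‖f y‖ ≤ S.indicator (fun _ => c) y) : ‖∫ y, f y‖ ≤ c * volume.real S := by
  refine (norm_integral_le_of_norm_le (g := S.indicator fun _ => c) ?_
    (Eventually.of_forall hf)).trans ?_
  · exact (integrable_indicator_iff hS).2 (integrableOn_const hfin)
  · rw [integral_indicator hS, setIntegral_const, smul_eq_mul, mul_comm]

theorem norm_avg_le {w : EuclideanSpace ℝ (Fin N) → ℝ}
    {κ : EuclideanSpace ℝ (Fin N) → F} (hs : tsupport κ ⊆ ball 0 2) {L : ℝ}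
    (hL : ∀ v, ‖κ v‖ ≤ L) {r : ℝ} (hr : 0 < r) {x : EuclideanSpace ℝ (Fin N)} {m : ℝ} (hm : 0 ≤ m)
    {S : Set (EuclideanSpace ℝ (Fin N))} (hS : MeasurableSet S) (hfin : volume S ≠ ⊤)
    (hw : ∀ y ∈ ball x (2 * r), |w y| ≤ S.indicator (fun _ => m) y) :
    ‖avg w κ r x‖ ≤ L * m * ((r ^ N)⁻¹ * volume.real S) := by
  have hL0 : 0 ≤ L := (norm_nonneg _).trans (hL 0)
  have h : ‖∫ y, w y • κ (r⁻¹ • (x - y))‖ ≤ (m * L) * volume.real S := by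
    refine norm_integral_le_of_le_indicator hS hfin fun y => ?_
    by_cases hy : y ∈ ball x (2 * r)
    · have := hw y hy
      rw [norm_smul, Real.norm_eq_abs]
      by_cases hyS : y ∈ S
      · simp only [hyS, indicator_of_mem] at this ⊢
        exact mul_le_mul this (hL _) (norm_nonneg _) hm
      · simp only [hyS, not_false_eq_true, indicator_of_notMem] at this ⊢
        rw [le_antisymm this (abs_nonneg _), zero_mul]
    · rw [kernel_eq_zero hs hr hy]
      simp only [smul_zero, norm_zero]
      exact indicator_nonneg (fun _ _ => mul_nonneg hm hL0) _
  rw [avg, norm_smul, norm_inv, norm_pow, Real.norm_of_nonneg hr.le]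
  calc _ ≤ (r ^ N)⁻¹ * ((m * L) * volume.real S) := by gcongr
    _ = _ := by ring

theorem norm_avg_taylor_le {w : EuclideanSpace ℝ (Fin N) → ℝ} (hwi : LocallyIntegrable w)
    {κ : EuclideanSpace ℝ (Fin N) → F} (hκ : ContDiff ℝ 1 κ) (hs : tsupport κ ⊆ ball 0 2) {L : ℝ}
    (hL : ∀ a b, ‖κ a - κ b - fderiv ℝ κ b (a - b)‖ ≤ L * ‖a - b‖ ^ 2) (hL0 : 0 ≤ L)
    {r : ℝ} (hr : 0 < r) {x x' : EuclideanSpace ℝ (Fin N)} {m : ℝ} (hm : 0 ≤ m)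
    {S : Set (EuclideanSpace ℝ (Fin N))} (hS : MeasurableSet S) (hfin : volume S ≠ ⊤)
    (hw : ∀ y ∈ ball x (2 * r) ∪ ball x' (2 * r), |w y| ≤ S.indicator (fun _ => m) y) :
    ‖avg w κ r x - avg w κ r x' - (r⁻¹ • avg w (fderiv ℝ κ) r x') (x - x')‖ ≤
      L * m * (‖x - x'‖ / r) ^ 2 * ((r ^ N)⁻¹ * volume.real S) := by
  have hs' : tsupport (fderiv ℝ κ) ⊆ ball 0 2 := (tsupport_fderiv_subset ℝ).trans hs
  have i1 := integrable_avg hwi hκ.continuous hs hr x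
  have i2 := integrable_avg hwi hκ.continuous hs hr x'
  have i3 := integrable_avg hwi (hκ.continuous_fderiv (by simp)) hs' hr x'
  have i12 : Integrable (fun y => w y • κ (r⁻¹ • (x - y)) - w y • κ (r⁻¹ • (x' - y))) := i1.sub i2
  have i4 := i3.apply_continuousLinearMap (r⁻¹ • (x - x'))
  have key : avg w κ r x - avg w κ r x' - (r⁻¹ • avg w (fderiv ℝ κ) r x') (x - x') =
      (r ^ N)⁻¹ • ∫ y, w y • (κ (r⁻¹ • (x - y)) - κ (r⁻¹ • (x' - y)) -
        fderiv ℝ κ (r⁻¹ • (x' - y)) (r⁻¹ • (x - y) - r⁻¹ • (x' - y))) := by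
    have e1 : (r⁻¹ • avg w (fderiv ℝ κ) r x') (x - x') =
        (r ^ N)⁻¹ • ∫ y, (w y • fderiv ℝ κ (r⁻¹ • (x' - y))) (r⁻¹ • (x - x')) := by
      rw [← ContinuousLinearMap.integral_apply i3, avg]
      simp only [smul_apply, map_smul]
      rw [smul_comm]
    rw [e1, avg, avg, ← smul_sub, ← smul_sub, ← integral_sub i1 i2, ← integral_sub i12 i4]
    congr 2
    funext y
    rw [← smul_sub r⁻¹, show x - y - (x' - y) = x - x' by abel, smul_sub (w y), smul_sub (w y)]
    rfl
  have h : ‖∫ y, w y • (κ (r⁻¹ • (x - y)) - κ (r⁻¹ • (x' - y)) -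
        fderiv ℝ κ (r⁻¹ • (x' - y)) (r⁻¹ • (x - y) - r⁻¹ • (x' - y)))‖ ≤
      (m * (L * (‖x - x'‖ / r) ^ 2)) * volume.real S := by
    refine norm_integral_le_of_le_indicator hS hfin fun y => ?_
    have hT := hL (r⁻¹ • (x - y)) (r⁻¹ • (x' - y))
    rw [← smul_sub r⁻¹, show x - y - (x' - y) = x - x' by abel, norm_smul (r⁻¹) (x - x'), norm_inv,
      Real.norm_of_nonneg hr.le, inv_mul_eq_div] at hT
    rw [← smul_sub r⁻¹, show x - y - (x' - y) = x - x' by abel]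
    by_cases hy : y ∈ ball x (2 * r) ∪ ball x' (2 * r)
    · have := hw y hy
      rw [norm_smul, Real.norm_eq_abs]
      by_cases hyS : y ∈ S
      · simp only [hyS, indicator_of_mem] at this ⊢
        exact mul_le_mul this hT (norm_nonneg _) hm
      · simp only [hyS, not_false_eq_true, indicator_of_notMem] at this ⊢
        rw [le_antisymm this (abs_nonneg _), zero_mul]
    · rw [mem_union, not_or] at hy
      rw [kernel_eq_zero hs hr hy.1, kernel_eq_zero hs hr hy.2, kernel_eq_zero hs' hr hy.2]
      simp only [sub_zero, zero_apply, smul_zero, norm_zero]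
      exact indicator_nonneg (fun _ _ => by positivity) _
  rw [key, norm_smul, norm_inv, norm_pow, Real.norm_of_nonneg hr.le]
  calc _ ≤ (r ^ N)⁻¹ * ((m * (L * (‖x - x'‖ / r) ^ 2)) * volume.real S) := by gcongr
    _ = _ := by ring

theorem exists_norm_le_of_tsupport_subset {G : Type*} [NormedAddCommGroup G]
    {κ : EuclideanSpace ℝ (Fin N) → G} (hκ : Continuous κ) (hs : tsupport κ ⊆ ball 0 2) :
    ∃ A, 0 ≤ A ∧ ∀ v, ‖κ v‖ ≤ A := by
  obtain ⟨A, hA⟩ := hκ.bounded_above_of_compact_support (hasCompactSupport_of_tsupport_subset hs)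
  exact ⟨A, (norm_nonneg _).trans (hA 0), hA⟩

/-- The first order Taylor remainder is controlled by a bound on the second derivative. -/
theorem norm_taylor_le {G : Type*} [NormedAddCommGroup G] [NormedSpace ℝ G]
    {κ : EuclideanSpace ℝ (Fin N) → G} (hd0 : Differentiable ℝ κ)
    (hd1 : Differentiable ℝ (fderiv ℝ κ)) {C : ℝ}
    (hC : ∀ v, ‖fderiv ℝ (fderiv ℝ κ) v‖ ≤ C) (a b : EuclideanSpace ℝ (Fin N)) :
    ‖κ a - κ b - fderiv ℝ κ b (a - b)‖ ≤ C * ‖a - b‖ ^ 2 := by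
  have hC0 : 0 ≤ C := (norm_nonneg (fderiv ℝ (fderiv ℝ κ) 0)).trans (hC 0)
  have hlip : ∀ c, ‖fderiv ℝ κ c - fderiv ℝ κ b‖ ≤ C * ‖c - b‖ := fun c =>
    Convex.norm_image_sub_le_of_norm_fderiv_le (𝕜 := ℝ) (f := fderiv ℝ κ) (s := univ)
      (fun y _ => hd1 y) (fun y _ => hC y) convex_univ (mem_univ b) (mem_univ c)
  have := (convex_segment b a).norm_image_sub_le_of_norm_fderiv_le' (f := κ)
    (φ := fderiv ℝ κ b) (C := C * ‖a - b‖) (x := b) (y := a)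
    (fun y _ => hd0 y)
    (fun y hy => (hlip y).trans (by
      have : ‖y - b‖ ≤ ‖a - b‖ := by
        rw [norm_sub_rev a b]
        have := norm_sub_le_of_mem_segment hy
        rwa [norm_sub_rev b a]
      gcongr))
    (left_mem_segment ℝ b a) (right_mem_segment ℝ b a)
  calc _ ≤ C * ‖a - b‖ * ‖a - b‖ := this
    _ = C * ‖a - b‖ ^ 2 := by ring

/-- Uniform bounds for a test kernel, its derivative, and its Taylor remainder. -/
theorem exists_kernel_bound {κ : EuclideanSpace ℝ (Fin N) → F} (hκ : ContDiff ℝ (⊤ : ℕ∞) κ)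
    (hs : tsupport κ ⊆ ball 0 2) : ∃ L, 0 ≤ L ∧ (∀ v, ‖κ v‖ ≤ L) ∧ (∀ v, ‖fderiv ℝ κ v‖ ≤ L) ∧
      ∀ a b, ‖κ a - κ b - fderiv ℝ κ b (a - b)‖ ≤ L * ‖a - b‖ ^ 2 := by
  have hs' : tsupport (fderiv ℝ κ) ⊆ ball 0 2 := (tsupport_fderiv_subset ℝ).trans hs
  have h1 : ContDiff ℝ (⊤ : ℕ∞) (fderiv ℝ κ) := (contDiff_infty_iff_fderiv.1 hκ).2
  have h2 : ContDiff ℝ (⊤ : ℕ∞) (fderiv ℝ (fderiv ℝ κ)) := (contDiff_infty_iff_fderiv.1 h1).2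
  obtain ⟨A, hA0, hA⟩ := exists_norm_le_of_tsupport_subset hκ.continuous hs
  obtain ⟨B, hB0, hB⟩ := exists_norm_le_of_tsupport_subset h1.continuous hs'
  obtain ⟨C, hC0, hC⟩ := exists_norm_le_of_tsupport_subset h2.continuous
    ((tsupport_fderiv_subset ℝ).trans hs')
  exact ⟨A + B + C, by positivity, fun v => (hA v).trans (by linarith),
    fun v => (hB v).trans (by linarith), fun a b =>
      norm_taylor_le (hκ.differentiable (by simp)) (h1.differentiable (by simp))
        (fun v => (hC v).trans (by linarith)) a b⟩

theorem integral_rescale (κ : EuclideanSpace ℝ (Fin N) → F) {r : ℝ} (hr : 0 < r)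
    (x : EuclideanSpace ℝ (Fin N)) : (r ^ N)⁻¹ • ∫ y, κ (r⁻¹ • (x - y)) = ∫ y, κ y := by
  rw [integral_sub_left_eq_self (fun y => κ (r⁻¹ • y)) volume x, Measure.integral_comp_smul]
  simp only [finrank_euclideanSpace, Fintype.card_fin, inv_pow, inv_inv]
  rw [abs_of_pos (by positivity), smul_smul, inv_mul_cancel₀ (by positivity), one_smul]

end Avg

section Rescaling

variable {N : ℕ}

theorem fderiv_rescale {G : Type*} [NormedAddCommGroup G] [NormedSpace ℝ G]
    {f : EuclideanSpace ℝ (Fin N) → G} (hf : Differentiable ℝ f) (r : ℝ)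
    (x y v : EuclideanSpace ℝ (Fin N)) :
    fderiv ℝ (fun y => f (r⁻¹ • (x - y))) y v = -(r⁻¹ • fderiv ℝ f (r⁻¹ • (x - y)) v) := by
  have h1 : HasFDerivAt (fun y : EuclideanSpace ℝ (Fin N) => r⁻¹ • (x - y))
      (r⁻¹ • (-ContinuousLinearMap.id ℝ (EuclideanSpace ℝ (Fin N)))) y :=
    ((hasFDerivAt_id y).const_sub x).const_smul r⁻¹
  have h2 := ((hf (r⁻¹ • (x - y))).hasFDerivAt.comp y h1).fderiv
  rw [show (fun y => f (r⁻¹ • (x - y))) = f ∘ fun y => r⁻¹ • (x - y) from rfl, h2]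
  simp

theorem lap_eq_sum {f : EuclideanSpace ℝ (Fin N) → ℝ} (hf : ContDiff ℝ (⊤ : ℕ∞) f)
    (x : EuclideanSpace ℝ (Fin N)) :
    lap N f x = ∑ i : Fin N, fderiv ℝ (fderiv ℝ f) x (EuclideanSpace.single i 1)
      (EuclideanSpace.single i 1) := by
  unfold lap
  refine Finset.sum_congr rfl fun i _ => ?_
  have h : DifferentiableAt ℝ (fderiv ℝ f) x :=
    ((contDiff_infty_iff_fderiv.1 hf).2.differentiable (by simp)) x
  rw [fderiv_clm_apply h (differentiableAt_const _)]
  simp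

theorem lap_rescale {f : EuclideanSpace ℝ (Fin N) → ℝ} (hf : ContDiff ℝ (⊤ : ℕ∞) f) (r : ℝ)
    (x y : EuclideanSpace ℝ (Fin N)) :
    lap N (fun y => f (r⁻¹ • (x - y))) y = r⁻¹ ^ 2 * lap N f (r⁻¹ • (x - y)) := by
  unfold lap
  rw [Finset.mul_sum]
  refine Finset.sum_congr rfl fun i _ => ?_
  set e : EuclideanSpace ℝ (Fin N) := EuclideanSpace.single i 1
  have hd : Differentiable ℝ (fun y => fderiv ℝ f y e) :=
    ((contDiff_infty_iff_fderiv.1 hf).2.clm_apply contDiff_const).differentiable (by simp)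
  have h1 : (fun y => fderiv ℝ (fun y => f (r⁻¹ • (x - y))) y e) =
      fun y => (-r⁻¹) • (fun y => fderiv ℝ f y e) (r⁻¹ • (x - y)) := by
    funext y
    rw [fderiv_rescale (hf.differentiable (by simp))]
    simp
  have hd' : DifferentiableAt ℝ (fun y => (fun y => fderiv ℝ f y e) (r⁻¹ • (x - y))) y :=
    (hd.comp (by fun_prop : Differentiable ℝ fun y : EuclideanSpace ℝ (Fin N) => r⁻¹ • (x - y))) y
  rw [h1, fderiv_fun_const_smul hd', smul_apply, fderiv_rescale hd]
  simp only [smul_eq_mul]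
  ring

theorem tsupport_rescale_subset {F : Type*} [NormedAddCommGroup F]
    {κ : EuclideanSpace ℝ (Fin N) → F} (hs : tsupport κ ⊆ ball 0 2) {r : ℝ} (hr : 0 < r)
    (x : EuclideanSpace ℝ (Fin N)) :
    tsupport (fun y => κ (r⁻¹ • (x - y))) ⊆ closedBall x (2 * r) := by
  refine closure_minimal (fun y hy => ?_) isClosed_closedBall
  by_contra h
  exact hy (kernel_eq_zero hs hr fun h' => h (ball_subset_closedBall h'))

theorem contDiff_rescale {F : Type*} [NormedAddCommGroup F] [NormedSpace ℝ F]
    {κ : EuclideanSpace ℝ (Fin N) → F} {n : WithTop ℕ∞} (hκ : ContDiff ℝ n κ) (r : ℝ)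
    (x : EuclideanSpace ℝ (Fin N)) : ContDiff ℝ n (fun y => κ (r⁻¹ • (x - y))) :=
  hκ.comp ((contDiff_const.sub contDiff_id).const_smul _)

end Rescaling

section Mollification

variable {N : ℕ} (K : DyadicKernel N)

namespace DyadicKernel

theorem dφ_smooth : ContDiff ℝ (⊤ : ℕ∞) (fderiv ℝ K.φ) := (contDiff_infty_iff_fderiv.1 K.φ_smooth).2

theorem dΨ_smooth : ContDiff ℝ (⊤ : ℕ∞) (fderiv ℝ K.Ψ) := (contDiff_infty_iff_fderiv.1 K.Ψ_smooth).2

theorem ddφ_smooth : ContDiff ℝ (⊤ : ℕ∞) (fderiv ℝ (fderiv ℝ K.φ)) :=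
  (contDiff_infty_iff_fderiv.1 K.dφ_smooth).2

theorem dφ_supp : tsupport (fderiv ℝ K.φ) ⊆ ball 0 2 := (tsupport_fderiv_subset ℝ).trans K.φ_supp

theorem dΨ_supp : tsupport (fderiv ℝ K.Ψ) ⊆ ball 0 2 := (tsupport_fderiv_subset ℝ).trans K.Ψ_supp

theorem ddφ_supp : tsupport (fderiv ℝ (fderiv ℝ K.φ)) ⊆ ball 0 2 :=
  (tsupport_fderiv_subset ℝ).trans K.dφ_supp

theorem ddΨ_supp : tsupport (fderiv ℝ (fderiv ℝ K.Ψ)) ⊆ ball 0 2 :=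
  (tsupport_fderiv_subset ℝ).trans K.dΨ_supp

/-- The mollification of `u` at scale `r`. -/
def U (u : EuclideanSpace ℝ (Fin N) → ℝ) (r : ℝ) (x : EuclideanSpace ℝ (Fin N)) : ℝ :=
  avg u K.φ r x

/-- The derivative of the mollification of `u` at scale `r`. -/
def P (u : EuclideanSpace ℝ (Fin N) → ℝ) (r : ℝ) (x : EuclideanSpace ℝ (Fin N)) :
    EuclideanSpace ℝ (Fin N) →L[ℝ] ℝ :=
  r⁻¹ • avg u (fderiv ℝ K.φ) r x

/-- The second derivative of the mollification of `u` at scale `r`. -/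
def Q (u : EuclideanSpace ℝ (Fin N) → ℝ) (r : ℝ) (x : EuclideanSpace ℝ (Fin N)) :
    EuclideanSpace ℝ (Fin N) →L[ℝ] EuclideanSpace ℝ (Fin N) →L[ℝ] ℝ :=
  r⁻¹ • r⁻¹ • avg u (fderiv ℝ (fderiv ℝ K.φ)) r x

variable {u : EuclideanSpace ℝ (Fin N) → ℝ}

theorem hasFDerivAt_U (hu : Continuous u) {r : ℝ} (hr : 0 < r) (x : EuclideanSpace ℝ (Fin N)) :
    HasFDerivAt (K.U u r) (K.P u r x) x :=
  hasFDerivAt_avg hu.locallyIntegrable (K.φ_smooth.of_le (by simp)) K.φ_supp hr x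

theorem hasFDerivAt_P (hu : Continuous u) {r : ℝ} (hr : 0 < r) (x : EuclideanSpace ℝ (Fin N)) :
    HasFDerivAt (K.P u r) (K.Q u r x) x :=
  (hasFDerivAt_avg hu.locallyIntegrable (K.dφ_smooth.of_le (by simp)) K.dφ_supp hr x).const_smul r⁻¹

theorem Q_symm (hu : Continuous u) {r : ℝ} (hr : 0 < r) (x v w : EuclideanSpace ℝ (Fin N)) :
    K.Q u r x v w = K.Q u r x w v :=
  second_derivative_symmetric (fun y => K.hasFDerivAt_U hu hr y) (K.hasFDerivAt_P hu hr x) v w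

theorem integral_φ_rescale {r : ℝ} (hr : 0 < r) (x : EuclideanSpace ℝ (Fin N)) :
    (r ^ N)⁻¹ * ∫ y, K.φ (r⁻¹ • (x - y)) = 1 := by
  have := integral_rescale K.φ hr x
  rwa [K.integral_φ] at this

theorem integrable_φ_rescale {r : ℝ} (hr : 0 < r) (x : EuclideanSpace ℝ (Fin N)) :
    Integrable (fun y => K.φ (r⁻¹ • (x - y))) := by
  simpa using integrable_avg (w := fun _ => (1 : ℝ)) continuous_const.locallyIntegrable
    K.φ_smooth.continuous K.φ_supp hr x

theorem integrable_Ψ_rescale {r : ℝ} (hr : 0 < r) (x : EuclideanSpace ℝ (Fin N)) :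
    Integrable (fun y => K.Ψ (r⁻¹ • (x - y))) := by
  simpa using integrable_avg (w := fun _ => (1 : ℝ)) continuous_const.locallyIntegrable
    K.Ψ_smooth.continuous K.Ψ_supp hr x

/-- An average against `φ` is bounded by a bound on the integrand. -/
theorem abs_avg_sub_le {w : EuclideanSpace ℝ (Fin N) → ℝ} (hw : Continuous w) {r : ℝ} (hr : 0 < r)
    (x : EuclideanSpace ℝ (Fin N)) {c ε : ℝ} (h : ∀ y ∈ ball x (2 * r), |w y - c| ≤ ε) :
    |avg w K.φ r x - c| ≤ ε := by
  have i1 : Integrable (fun y => w y * K.φ (r⁻¹ • (x - y))) :=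
    integrable_avg hw.locallyIntegrable K.φ_smooth.continuous K.φ_supp hr x
  have i2 := K.integrable_φ_rescale hr x
  have e1 : avg w K.φ r x - c =
      (r ^ N)⁻¹ * ∫ y, (w y * K.φ (r⁻¹ • (x - y)) - c * K.φ (r⁻¹ • (x - y))) := by
    rw [integral_sub i1 (i2.const_mul c), integral_const_mul, mul_sub, mul_left_comm _ c,
      K.integral_φ_rescale hr x, mul_one]
    rfl
  have e2 : |∫ y, (w y * K.φ (r⁻¹ • (x - y)) - c * K.φ (r⁻¹ • (x - y)))| ≤
      ∫ y, ε * K.φ (r⁻¹ • (x - y)) := by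
    rw [← Real.norm_eq_abs]
    refine norm_integral_le_of_norm_le (i2.const_mul ε) (Eventually.of_forall fun y => ?_)
    rw [← sub_mul, Real.norm_eq_abs, abs_mul, abs_of_nonneg (K.φ_nonneg _)]
    by_cases hy : y ∈ ball x (2 * r)
    · exact mul_le_mul_of_nonneg_right (h y hy) (K.φ_nonneg _)
    · rw [kernel_eq_zero K.φ_supp hr hy, mul_zero, mul_zero]
  rw [e1, abs_mul, abs_of_pos (by positivity)]
  calc _ ≤ (r ^ N)⁻¹ * ∫ y, ε * K.φ (r⁻¹ • (x - y)) := by gcongr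
    _ = ε := by
      rw [integral_const_mul, mul_left_comm, K.integral_φ_rescale hr x, mul_one]

theorem tendsto_avg {w : EuclideanSpace ℝ (Fin N) → ℝ} (hw : Continuous w)
    (x : EuclideanSpace ℝ (Fin N)) :
    Tendsto (fun r => avg w K.φ r x) (nhdsWithin 0 (Ioi 0)) (nhds (w x)) := by
  rw [Metric.tendsto_nhds]
  intro ε hε
  obtain ⟨δ, hδ, h⟩ := Metric.continuous_iff.1 hw x (ε / 2) (by positivity)
  filter_upwards [Ioo_mem_nhdsGT (show (0 : ℝ) < δ / 2 by positivity)] with r hr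
  have := K.abs_avg_sub_le hw hr.1 x (c := w x) (ε := ε / 2) fun y hy => by
    have hy' : dist y x < 2 * r := hy
    exact (h y (by linarith [hr.2])).le
  rw [Real.dist_eq]
  linarith

theorem P_apply (hu : ContDiff ℝ 1 u) {r : ℝ} (hr : 0 < r) (x v : EuclideanSpace ℝ (Fin N)) :
    K.P u r x v = avg (fun y => fderiv ℝ u y v) K.φ r x := by
  have hζ : ContDiff ℝ 1 (fun y => K.φ (r⁻¹ • (x - y))) :=
    contDiff_rescale (K.φ_smooth.of_le (by simp)) r x
  have hζc := hasCompactSupport_rescale K.φ_supp hr x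
  have hζ1 : Continuous fun y => fderiv ℝ (fun y => K.φ (r⁻¹ • (x - y))) y v :=
    (hζ.continuous_fderiv (by simp)).clm_apply continuous_const
  have hu1 : Continuous fun y => fderiv ℝ u y v :=
    (hu.continuous_fderiv (by simp)).clm_apply continuous_const
  have hζc1 : HasCompactSupport fun y => fderiv ℝ (fun y => K.φ (r⁻¹ • (x - y))) y v :=
    hζc.fderiv_apply ℝ v
  have ibp := integral_mul_fderiv_eq_neg_fderiv_mul_of_integrable (μ := volume) (v := v)
    (f := u) (g := fun y => K.φ (r⁻¹ • (x - y)))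
    ((hu1.mul hζ.continuous).integrable_of_hasCompactSupport hζc.mul_left)
    ((hu.continuous.mul hζ1).integrable_of_hasCompactSupport hζc1.mul_left)
    ((hu.continuous.mul hζ.continuous).integrable_of_hasCompactSupport hζc.mul_left)
    (fun y _ => hu.differentiable (by simp) y) (fun y _ => hζ.differentiable (by simp) y)
  simp only [fderiv_rescale (K.φ_smooth.differentiable (by simp))] at ibp
  have i3 := integrable_avg hu.continuous.locallyIntegrable K.dφ_smooth.continuous K.dφ_supp hr x
  rw [P, avg, avg, smul_apply, smul_apply, ContinuousLinearMap.integral_apply i3]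
  simp only [smul_apply, smul_eq_mul] at ibp ⊢
  have e : ∫ y, u y * -(r⁻¹ * fderiv ℝ K.φ (r⁻¹ • (x - y)) v) =
      -(r⁻¹ * ∫ y, u y * fderiv ℝ K.φ (r⁻¹ • (x - y)) v) := by
    rw [← integral_const_mul, ← integral_neg]
    congr 1; funext y; ring
  rw [e, neg_inj] at ibp
  rw [← ibp]; ring

end DyadicKernel

end Mollification

section Membership

variable {N : ℕ}

/-- The indicator function of the complement of `Ω`. -/
def coind (Ω : Set (EuclideanSpace ℝ (Fin N))) : EuclideanSpace ℝ (Fin N) → ℝ :=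
  Ωᶜ.indicator fun _ => 1

theorem coind_nonneg (Ω : Set (EuclideanSpace ℝ (Fin N))) (y : EuclideanSpace ℝ (Fin N)) :
    0 ≤ coind Ω y := indicator_nonneg (fun _ _ => zero_le_one) y

theorem coind_le_one (Ω : Set (EuclideanSpace ℝ (Fin N))) (y : EuclideanSpace ℝ (Fin N)) :
    coind Ω y ≤ 1 := indicator_le_self' (fun _ _ => zero_le_one) y

theorem locallyIntegrable_coind {Ω : Set (EuclideanSpace ℝ (Fin N))} (hΩ : IsOpen Ω) :
    LocallyIntegrable (coind Ω) :=
  (continuous_const (y := (1 : ℝ))).locallyIntegrable.indicator hΩ.measurableSet.compl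

theorem setIntegral_eq_sub_coind {Ω : Set (EuclideanSpace ℝ (Fin N))} (hΩ : IsOpen Ω)
    {ζ : EuclideanSpace ℝ (Fin N) → ℝ} (hζ : Integrable ζ) :
    ∫ y in Ω, ζ y = (∫ y, ζ y) - ∫ y, coind Ω y * ζ y := by
  have h1 : ∫ y, coind Ω y * ζ y = ∫ y in Ωᶜ, ζ y := by
    rw [← integral_indicator hΩ.measurableSet.compl]
    congr 1
    funext y
    by_cases hy : y ∈ Ωᶜ
    · simp only [coind, indicator_of_mem hy, one_mul]
    · simp only [coind, indicator_of_notMem hy, zero_mul]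
  rw [h1, ← integral_add_compl hΩ.measurableSet hζ]
  ring

variable {z : EuclideanSpace ℝ (Fin N)} {M : ℝ} {Ω : Set (EuclideanSpace ℝ (Fin N))}
  {u : EuclideanSpace ℝ (Fin N) → ℝ}

namespace MemP

theorem isOpen (h : MemP N 1 z M Ω u) : IsOpen Ω := h.1

theorem contDiff (h : MemP N 1 z M Ω u) : ContDiff ℝ 1 u := h.2.1

theorem continuous (h : MemP N 1 z M Ω u) : Continuous u := h.2.1.continuous

theorem abs_le (h : MemP N 1 z M Ω u) {x : EuclideanSpace ℝ (Fin N)} (hx : x ∈ ball z 1) :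
    |u x| ≤ M := h.2.2.2.2.1 x hx

theorem eq_zero (h : MemP N 1 z M Ω u) {x : EuclideanSpace ℝ (Fin N)} (hx : x ∈ ball z 1)
    (hxΩ : x ∉ Ω) : u x = 0 := (h.2.2.2.1 x ⟨hx, hxΩ⟩).1

theorem fderiv_eq_zero (h : MemP N 1 z M Ω u) {x : EuclideanSpace ℝ (Fin N)} (hx : x ∈ ball z 1)
    (hxΩ : x ∉ Ω) : fderiv ℝ u x = 0 := by
  have := (h.2.2.2.1 x ⟨hx, hxΩ⟩).2
  simpa [gradient] using this

theorem notMem (h : MemP N 1 z M Ω u) : z ∉ Ω := by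
  have := h.2.2.2.2.2
  rw [h.isOpen.frontier_eq] at this
  exact this.2

theorem integral_rescaled_lap (h : MemP N 1 z M Ω u) {ψ : EuclideanSpace ℝ (Fin N) → ℝ}
    (hψ : ContDiff ℝ (⊤ : ℕ∞) ψ) (hs : tsupport ψ ⊆ ball 0 2) {r : ℝ} (hr : 0 < r)
    {x : EuclideanSpace ℝ (Fin N)} (hx : ‖x - z‖ + 2 * r < 1) :
    r⁻¹ ^ 2 * ∫ y, u y * lap N ψ (r⁻¹ • (x - y)) =
      (∫ y, ψ (r⁻¹ • (x - y))) - ∫ y, coind Ω y * ψ (r⁻¹ • (x - y)) := by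
  have hc := contDiff_rescale hψ r x
  have hsub : tsupport (fun y => ψ (r⁻¹ • (x - y))) ⊆ ball z 1 :=
    (tsupport_rescale_subset hs hr x).trans
      (closedBall_subset_ball' (by rw [dist_eq_norm]; linarith))
  have := h.2.2.1 _ hc hsub
  simp only [lap_rescale hψ] at this
  rw [setIntegral_eq_sub_coind h.isOpen
    (hc.continuous.integrable_of_hasCompactSupport (hasCompactSupport_rescale hs hr x))] at this
  rw [← this, ← integral_const_mul]
  congr 1; funext y; ring

variable (K : DyadicKernel N)

theorem U_step (h : MemP N 1 z M Ω u) {r : ℝ} (hr : 0 < r) {x : EuclideanSpace ℝ (Fin N)}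
    (hx : ‖x - z‖ + 2 * r < 1) :
    K.U u (2 * r) x - K.U u r x = r ^ 2 * ((∫ y, K.Ψ y) - avg (coind Ω) K.Ψ r x) := by
  have key := h.integral_rescaled_lap K.Ψ_smooth K.Ψ_supp hr hx
  have i1 : Integrable (fun y => u y * K.φ ((2 * r)⁻¹ • (x - y))) :=
    integrable_avg h.continuous.locallyIntegrable K.φ_smooth.continuous K.φ_supp (by positivity) x
  have i2 : Integrable (fun y => u y * K.φ (r⁻¹ • (x - y))) :=
    integrable_avg h.continuous.locallyIntegrable K.φ_smooth.continuous K.φ_supp hr x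
  have e : ∫ y, u y * lap N K.Ψ (r⁻¹ • (x - y)) =
      ((2 : ℝ) ^ N)⁻¹ * (∫ y, u y * K.φ ((2 * r)⁻¹ • (x - y))) -
        ∫ y, u y * K.φ (r⁻¹ • (x - y)) := by
    rw [← integral_const_mul, ← integral_sub (i1.const_mul _) i2]
    congr 1; funext y
    rw [K.lap_Ψ, smul_smul, ← mul_inv]
    ring
  rw [e] at key
  rw [← integral_rescale K.Ψ hr x, DyadicKernel.U, DyadicKernel.U, avg, avg, avg]
  simp only [smul_eq_mul]
  rw [← mul_sub, ← key, mul_pow, mul_inv]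
  field_simp

theorem P_step (h : MemP N 1 z M Ω u) {r : ℝ} (hr : 0 < r) {x : EuclideanSpace ℝ (Fin N)}
    (hx : ‖x - z‖ + 2 * r < 1) :
    K.P u (2 * r) x - K.P u r x = -(r • avg (coind Ω) (fderiv ℝ K.Ψ) r x) := by
  have h1 := (K.hasFDerivAt_U h.continuous (show 0 < 2 * r by positivity) x).sub
    (K.hasFDerivAt_U h.continuous hr x)
  have h2 := ((hasFDerivAt_avg (locallyIntegrable_coind h.isOpen)
    (K.Ψ_smooth.of_le (by simp)) K.Ψ_supp hr x).const_sub (∫ y, K.Ψ y)).const_mul (r ^ 2)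
  have hev : (fun y => r ^ 2 * ((∫ y, K.Ψ y) - avg (coind Ω) K.Ψ r y)) =ᶠ[nhds x]
      (K.U u (2 * r) - K.U u r) := by
    have : ∀ᶠ y in nhds x, ‖y - z‖ + 2 * r < 1 :=
      (by fun_prop : Continuous fun y : EuclideanSpace ℝ (Fin N) =>
        ‖y - z‖ + 2 * r).continuousAt.eventually_lt_const hx
    filter_upwards [this] with y hy
    exact (h.U_step K hr hy).symm
  rw [h1.unique (h2.congr_of_eventuallyEq hev.symm), smul_neg, smul_smul]
  congr 2
  field_simp

theorem Q_step (h : MemP N 1 z M Ω u) {r : ℝ} (hr : 0 < r) {x : EuclideanSpace ℝ (Fin N)}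
    (hx : ‖x - z‖ + 2 * r < 1) :
    K.Q u (2 * r) x - K.Q u r x = -avg (coind Ω) (fderiv ℝ (fderiv ℝ K.Ψ)) r x := by
  have h1 := (K.hasFDerivAt_P h.continuous (show 0 < 2 * r by positivity) x).sub
    (K.hasFDerivAt_P h.continuous hr x)
  have h2 := ((hasFDerivAt_avg (locallyIntegrable_coind h.isOpen)
    (K.dΨ_smooth.of_le (by simp)) K.dΨ_supp hr x).const_smul r).neg
  have hev : (-(r • avg (coind Ω) (fderiv ℝ K.Ψ) r)) =ᶠ[nhds x] (K.P u (2 * r) - K.P u r) := by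
    have : ∀ᶠ y in nhds x, ‖y - z‖ + 2 * r < 1 :=
      (by fun_prop : Continuous fun y : EuclideanSpace ℝ (Fin N) =>
        ‖y - z‖ + 2 * r).continuousAt.eventually_lt_const hx
    filter_upwards [this] with y hy
    exact (h.P_step K hr hy).symm
  rw [h1.unique (h2.congr_of_eventuallyEq hev.symm), smul_smul, mul_inv_cancel₀ hr.ne', one_smul]

theorem trace_Q_mem (h : MemP N 1 z M Ω u) {r : ℝ} (hr : 0 < r) {x : EuclideanSpace ℝ (Fin N)}
    (hx : ‖x - z‖ + 2 * r < 1) :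
    ∑ i : Fin N, K.Q u r x (EuclideanSpace.single i 1) (EuclideanSpace.single i 1) ∈
      Icc (0 : ℝ) 1 := by
  have key := h.integral_rescaled_lap K.φ_smooth K.φ_supp hr hx
  have i0 := integrable_avg h.continuous.locallyIntegrable K.ddφ_smooth.continuous K.ddφ_supp hr x
  have e : ∑ i : Fin N, K.Q u r x (EuclideanSpace.single i 1) (EuclideanSpace.single i 1) =
      (r ^ N)⁻¹ * ((∫ y, K.φ (r⁻¹ • (x - y))) - ∫ y, coind Ω y * K.φ (r⁻¹ • (x - y))) := by
    rw [← key]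
    have i1 : ∀ v : EuclideanSpace ℝ (Fin N),
        Integrable fun y => (u y • fderiv ℝ (fderiv ℝ K.φ) (r⁻¹ • (x - y))) v :=
      fun v => i0.apply_continuousLinearMap v
    have e1 : ∀ v, K.Q u r x v v = r⁻¹ * (r⁻¹ * ((r ^ N)⁻¹ *
        ∫ y, u y * fderiv ℝ (fderiv ℝ K.φ) (r⁻¹ • (x - y)) v v)) := by
      intro v
      have e2 : (∫ y, u y • fderiv ℝ (fderiv ℝ K.φ) (r⁻¹ • (x - y))) v v =
          ∫ y, u y * fderiv ℝ (fderiv ℝ K.φ) (r⁻¹ • (x - y)) v v := by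
        rw [ContinuousLinearMap.integral_apply i0, ContinuousLinearMap.integral_apply (i1 v)]
        rfl
      rw [← e2]
      rfl
    have i4 : ∀ v : EuclideanSpace ℝ (Fin N),
        Integrable fun y => u y * fderiv ℝ (fderiv ℝ K.φ) (r⁻¹ • (x - y)) v v :=
      fun v => (i1 v).apply_continuousLinearMap v
    simp only [e1]
    rw [← Finset.mul_sum, ← Finset.mul_sum, ← Finset.mul_sum,
      ← integral_finsetSum _ fun i _ => i4 (EuclideanSpace.single i 1)]
    simp only [lap_eq_sum K.φ_smooth, Finset.mul_sum]
    ring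
  have i2 := K.integrable_φ_rescale hr x
  have i3 : Integrable fun y => coind Ω y * K.φ (r⁻¹ • (x - y)) :=
    integrable_avg (locallyIntegrable_coind h.isOpen) K.φ_smooth.continuous K.φ_supp hr x
  have hle : ∫ y, coind Ω y * K.φ (r⁻¹ • (x - y)) ≤ ∫ y, K.φ (r⁻¹ • (x - y)) :=
    integral_mono i3 i2 fun y => mul_le_of_le_one_left (K.φ_nonneg _) (coind_le_one Ω y)
  have hge : 0 ≤ ∫ y, coind Ω y * K.φ (r⁻¹ • (x - y)) :=
    integral_nonneg fun y => mul_nonneg (coind_nonneg Ω y) (K.φ_nonneg _)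
  have h1 := K.integral_φ_rescale hr x
  have hrN : 0 < (r ^ N)⁻¹ := by positivity
  rw [e]
  refine ⟨mul_nonneg hrN.le (by linarith), ?_⟩
  rw [mul_sub, h1]
  linarith [mul_nonneg hrN.le hge]

end MemP

end Membership

section LowerBound

variable {N : ℕ} (K : DyadicKernel N)

theorem tendsto_div_two_pow {r : ℝ} (hr : 0 < r) :
    Tendsto (fun n : ℕ => r / 2 ^ n) atTop (nhdsWithin 0 (Ioi 0)) := by
  refine tendsto_nhdsWithin_iff.2 ⟨?_, Eventually.of_forall fun n => by
    rw [mem_Ioi]; positivity⟩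
  have := (tendsto_pow_atTop_nhds_zero_of_lt_one (r := (2 : ℝ)⁻¹) (by norm_num)
    (by norm_num)).const_mul r
  simpa [div_eq_mul_inv] using this

namespace DyadicKernel

theorem integral_Ψ_pos : 0 < ∫ y, K.Ψ y :=
  K.Ψ_smooth.continuous.integral_pos_of_hasCompactSupport_nonneg_nonzero
    (hasCompactSupport_of_tsupport_subset K.Ψ_supp) K.Ψ_nonneg K.Ψ_pos.ne'

/-- The part of the mass of `Ψ` seen by `Ω`. -/
theorem integral_Ψ_sub_avg_coind {Ω : Set (EuclideanSpace ℝ (Fin N))} (hΩ : IsOpen Ω) {r : ℝ}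
    (hr : 0 < r) (x : EuclideanSpace ℝ (Fin N)) :
    (∫ y, K.Ψ y) - avg (coind Ω) K.Ψ r x =
      (r ^ N)⁻¹ * ∫ y, (1 - coind Ω y) * K.Ψ (r⁻¹ • (x - y)) := by
  have i3 : Integrable fun y => coind Ω y * K.Ψ (r⁻¹ • (x - y)) :=
    integrable_avg (locallyIntegrable_coind hΩ) K.Ψ_smooth.continuous K.Ψ_supp hr x
  have i2 := K.integrable_Ψ_rescale hr x
  simp only [sub_mul, one_mul]
  rw [integral_sub i2 i3, ← integral_rescale K.Ψ hr x, avg]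
  simp only [smul_eq_mul]
  ring

theorem avg_norm_sq_le {s : ℝ} (hs : 0 < s) (x y : EuclideanSpace ℝ (Fin N)) :
    avg (fun t => ‖t - y‖ ^ 2) K.φ s x ≤ ‖x - y‖ ^ 2 + (2 * s) ^ 2 := by
  have hlin : ∫ t, ⟪t - x, x - y⟫ * K.φ (s⁻¹ • (x - t)) = 0 := by
    have e1 := integral_sub_left_eq_self (fun t => ⟪-t, x - y⟫ * K.φ (s⁻¹ • t)) volume x
    simp only [neg_sub] at e1
    rw [e1, ← integral_neg_eq_self (fun t => ⟪-t, x - y⟫ * K.φ (s⁻¹ • t))] 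
    have e2 : ∀ t, ⟪- -t, x - y⟫ * K.φ (s⁻¹ • -t) = -(⟪-t, x - y⟫ * K.φ (s⁻¹ • t)) := by
      intro t
      rw [smul_neg, K.φ_even, inner_neg_left]
      ring
    have e3 := integral_neg_eq_self (fun t => ⟪-t, x - y⟫ * K.φ (s⁻¹ • t)) volume
    simp only [e2, integral_neg] at e3 ⊢
    linarith
  have i1 := K.integrable_φ_rescale hs x
  have i2 : Integrable fun t => ⟪t - x, x - y⟫ * K.φ (s⁻¹ • (x - t)) :=
    integrable_avg (w := fun t => ⟪t - x, x - y⟫) (by fun_prop : Continuous _).locallyIntegrable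
      K.φ_smooth.continuous K.φ_supp hs x
  have i3 : Integrable fun t => ‖t - y‖ ^ 2 * K.φ (s⁻¹ • (x - t)) :=
    integrable_avg (w := fun t => ‖t - y‖ ^ 2) (by fun_prop : Continuous _).locallyIntegrable
      K.φ_smooth.continuous K.φ_supp hs x
  have hle : ∫ t, ‖t - y‖ ^ 2 * K.φ (s⁻¹ • (x - t)) ≤
      ∫ t, ((‖x - y‖ ^ 2 + (2 * s) ^ 2) * K.φ (s⁻¹ • (x - t)) +
        2 * (⟪t - x, x - y⟫ * K.φ (s⁻¹ • (x - t)))) := by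
    refine integral_mono i3 ((i1.const_mul _).add (i2.const_mul 2)) fun t => ?_
    by_cases ht : t ∈ ball x (2 * s)
    · have h1 : ‖t - x‖ < 2 * s := by rwa [← dist_eq_norm]
      have h2 : ‖t - y‖ ^ 2 = ‖t - x‖ ^ 2 + 2 * ⟪t - x, x - y⟫ + ‖x - y‖ ^ 2 := by
        rw [← norm_add_sq_real]; congr 2; abel
      have h3 : ‖t - x‖ ^ 2 ≤ (2 * s) ^ 2 := by gcongr
      have h4 := mul_le_mul_of_nonneg_right h3 (K.φ_nonneg (s⁻¹ • (x - t)))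
      simp only [h2]
      nlinarith
    · simp only [kernel_eq_zero K.φ_supp hs ht, mul_zero, add_zero, le_refl]
  rw [integral_add (i1.const_mul _) (i2.const_mul 2), integral_const_mul, integral_const_mul, hlin,
    mul_zero, add_zero] at hle
  have h5 := K.integral_φ_rescale hs x
  calc avg (fun t => ‖t - y‖ ^ 2) K.φ s x
      = (s ^ N)⁻¹ * ∫ t, ‖t - y‖ ^ 2 * K.φ (s⁻¹ • (x - t)) := rfl
    _ ≤ (s ^ N)⁻¹ * ((‖x - y‖ ^ 2 + (2 * s) ^ 2) * ∫ t, K.φ (s⁻¹ • (x - t))) := by gcongr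
    _ = _ := by rw [mul_left_comm, h5, mul_one]

end DyadicKernel

variable {z : EuclideanSpace ℝ (Fin N)} {M : ℝ} {Ω : Set (EuclideanSpace ℝ (Fin N))}
  {u : EuclideanSpace ℝ (Fin N) → ℝ}

namespace MemP

theorem U_le_U_two_mul (h : MemP N 1 z M Ω u) {r : ℝ} (hr : 0 < r)
    {x : EuclideanSpace ℝ (Fin N)} (hx : ‖x - z‖ + 2 * r < 1) : K.U u r x ≤ K.U u (2 * r) x := by
  rw [← sub_nonneg, h.U_step K hr hx, K.integral_Ψ_sub_avg_coind h.isOpen hr]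
  have : 0 ≤ ∫ y, (1 - coind Ω y) * K.Ψ (r⁻¹ • (x - y)) :=
    integral_nonneg fun y => mul_nonneg (sub_nonneg.2 (coind_le_one Ω y)) (K.Ψ_nonneg _)
  positivity

/-- The sub-mean value property. -/
theorem le_U (h : MemP N 1 z M Ω u) {r : ℝ} (hr : 0 < r)
    {x : EuclideanSpace ℝ (Fin N)} (hx : ‖x - z‖ + r < 1) : u x ≤ K.U u r x := by
  have hanti : Antitone fun n : ℕ => K.U u (r / 2 ^ n) x := by
    refine antitone_nat_of_succ_le fun n => ?_
    have h2 : 2 * (r / 2 ^ (n + 1)) = r / 2 ^ n := by rw [pow_succ]; field_simp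
    have h3 : r / 2 ^ n ≤ r := div_le_self hr.le (one_le_pow₀ (by norm_num))
    have := h.U_le_U_two_mul K (show 0 < r / 2 ^ (n + 1) by positivity) (x := x)
      (by rw [h2]; linarith)
    rwa [h2] at this
  have := hanti.le_of_tendsto ((K.tendsto_avg h.continuous x).comp (tendsto_div_two_pow hr)) 0
  simpa using this

theorem exists_pos (K : DyadicKernel N) (h : MemP N 1 z M Ω u) : ∃ y ∈ ball z (1 / 4), 0 < u y := by
  by_contra! hcon
  have hz : z ∈ ball z 1 := mem_ball_self one_pos
  have hle : K.U u (2 * (1 / 16)) z ≤ 0 := by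
    have : ∫ y, u y * K.φ ((2 * (1 / 16) : ℝ)⁻¹ • (z - y)) ≤ 0 := by
      refine integral_nonpos fun y => ?_
      by_cases hy : y ∈ ball z (2 * (2 * (1 / 16)))
      · exact mul_nonpos_of_nonpos_of_nonneg
          (hcon y (ball_subset_ball (by norm_num) hy)) (K.φ_nonneg _)
      · simp only [kernel_eq_zero K.φ_supp (show (0 : ℝ) < 2 * (1 / 16) by norm_num) hy, mul_zero,
          Pi.zero_apply, le_refl]
    exact mul_nonpos_of_nonneg_of_nonpos (by positivity) this
  have hge := h.le_U K (show (0 : ℝ) < 1 / 16 by norm_num) (x := z) (by norm_num)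
  rw [h.eq_zero hz h.notMem] at hge
  have hstep := h.U_step K (show (0 : ℝ) < 1 / 16 by norm_num) (x := z) (by norm_num)
  rw [K.integral_Ψ_sub_avg_coind h.isOpen (by norm_num)] at hstep
  have hpos : 0 < ∫ y, (1 - coind Ω y) * K.Ψ ((1 / 16 : ℝ)⁻¹ • (z - y)) := by
    have h_int : Integrable fun y => (1 - coind Ω y) * K.Ψ ((1 / 16 : ℝ)⁻¹ • (z - y)) :=
      integrable_avg (w := fun y => 1 - coind Ω y)
        ((continuous_const (y := (1 : ℝ))).locallyIntegrable.sub (locallyIntegrable_coind h.isOpen))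
        K.Ψ_smooth.continuous K.Ψ_supp (by norm_num) z
    rw [integral_pos_iff_support_of_nonneg (fun y =>
      mul_nonneg (sub_nonneg.2 (coind_le_one Ω y)) (K.Ψ_nonneg _)) h_int]
    have hopen : IsOpen {y | 0 < K.Ψ ((1 / 16 : ℝ)⁻¹ • (z - y))} :=
      isOpen_lt continuous_const (contDiff_rescale K.Ψ_smooth _ z).continuous
    have hzc : z ∈ closure Ω := h.2.2.2.2.2.1
    have hne : ({y | 0 < K.Ψ ((1 / 16 : ℝ)⁻¹ • (z - y))} ∩ Ω).Nonempty :=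
      mem_closure_iff.1 hzc _ hopen (by simpa using K.Ψ_pos)
    refine lt_of_lt_of_le ((hopen.inter h.isOpen).measure_pos volume hne) (measure_mono ?_)
    intro y hy
    have : coind Ω y = 0 := indicator_of_notMem (notMem_compl_iff.2 hy.2) _
    rw [Function.mem_support, this, sub_zero, one_mul]
    exact ne_of_gt hy.1
  have : 0 < (1 / 16 : ℝ) ^ 2 * (((1 / 16 : ℝ) ^ N)⁻¹ *
      ∫ y, (1 - coind Ω y) * K.Ψ ((1 / 16 : ℝ)⁻¹ • (z - y))) := by positivity
  linarith

/-- Nondegeneracy: the supremum of `u` cannot be too small. -/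
theorem integral_Ψ_le (h : MemP N 1 z M Ω u) : (∫ y, K.Ψ y) / 512 ≤ M := by
  set I := ∫ y, K.Ψ y with hI
  have hI0 : 0 < I := K.integral_Ψ_pos
  obtain ⟨y, hy, huy⟩ := h.exists_pos K
  have hyz : dist y z < 1 / 4 := hy
  set a := I / 32 with ha
  obtain ⟨x, hx, hmax⟩ := (isCompact_closedBall y (1 / 4)).exists_isMaxOn
    (nonempty_closedBall.2 (by norm_num)) (f := fun x => u x - a * ‖x - y‖ ^ 2)
    ((h.continuous.sub (by fun_prop)).continuousOn)
  have hmax' : ∀ t ∈ closedBall y (1 / 4), u t - a * ‖t - y‖ ^ 2 ≤ u x - a * ‖x - y‖ ^ 2 :=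
    fun t ht => hmax ht
  have hxy : ‖x - y‖ ≤ 1 / 4 := by rw [← dist_eq_norm]; exact hx
  have hwx := hmax' y (mem_closedBall_self (by norm_num))
  simp only [sub_self, norm_zero] at hwx
  have hxz : dist x z < 1 / 2 := by
    have := dist_triangle x y z
    have hx' : dist x y ≤ 1 / 4 := hx
    linarith
  have hux : 0 < u x := by nlinarith [mul_nonneg (show 0 ≤ a by positivity) (sq_nonneg ‖x - y‖)]
  have hxb : x ∈ ball z 1 := by rw [mem_ball]; linarith
  have hxM := h.abs_le hxb
  rw [abs_of_pos hux] at hxM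
  rcases hxy.lt_or_eq with hlt | heq
  · exfalso
    have hxΩ : x ∈ Ω := by
      by_contra hn
      exact hux.ne' (h.eq_zero hxb hn)
    obtain ⟨ε, hε, hball⟩ := Metric.isOpen_iff.1 h.isOpen x hxΩ
    obtain ⟨s, hs, hsm⟩ : ∃ s > 0, s < min (ε / 2) (min ((1 / 4 - ‖x - y‖) / 4) (1 / 8)) := by
      obtain ⟨s, hs, hs'⟩ := exists_between (show 0 <
        min (ε / 2) (min ((1 / 4 - ‖x - y‖) / 4) (1 / 8)) by
          have : 0 < 1 / 4 - ‖x - y‖ := by linarith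
          positivity)
      exact ⟨s, hs, hs'⟩
    have hs1 : s < ε / 2 := hsm.trans_le (min_le_left _ _)
    have hs2 : s < (1 / 4 - ‖x - y‖) / 4 :=
      hsm.trans_le ((min_le_right _ _).trans (min_le_left _ _))
    have hs3 : s < 1 / 8 := hsm.trans_le ((min_le_right _ _).trans (min_le_right _ _))
    rw [dist_eq_norm] at hxz
    have hstep := h.U_step K hs (x := x) (by linarith)
    have hge := h.le_U K hs (x := x) (by linarith)
    have havg : avg (coind Ω) K.Ψ s x = 0 := by
      have : ∀ t, coind Ω t • K.Ψ (s⁻¹ • (x - t)) = 0 := by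
        intro t
        by_cases ht : t ∈ ball x (2 * s)
        · have : t ∈ Ω := hball (ball_subset_ball (by linarith) ht)
          rw [coind, indicator_of_notMem (notMem_compl_iff.2 this), zero_smul]
        · rw [kernel_eq_zero K.Ψ_supp hs ht, smul_zero]
      simp only [avg, this, integral_zero, smul_zero]
    rw [havg, sub_zero] at hstep
    have i1 : Integrable fun t => u t * K.φ ((2 * s)⁻¹ • (x - t)) :=
      integrable_avg h.continuous.locallyIntegrable K.φ_smooth.continuous K.φ_supp
        (by positivity) x
    have i2 := K.integrable_φ_rescale (show 0 < 2 * s by positivity) x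
    have i3 : Integrable fun t => ‖t - y‖ ^ 2 * K.φ ((2 * s)⁻¹ • (x - t)) :=
      integrable_avg (w := fun t => ‖t - y‖ ^ 2) (by fun_prop : Continuous _).locallyIntegrable
        K.φ_smooth.continuous K.φ_supp (by positivity) x
    have hle : ∫ t, u t * K.φ ((2 * s)⁻¹ • (x - t)) ≤
        ∫ t, ((u x - a * ‖x - y‖ ^ 2) * K.φ ((2 * s)⁻¹ • (x - t)) +
          a * (‖t - y‖ ^ 2 * K.φ ((2 * s)⁻¹ • (x - t)))) := by
      refine integral_mono i1 ((i2.const_mul _).add (i3.const_mul a)) fun t => ?_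
      by_cases ht : t ∈ ball x (2 * (2 * s))
      · have h1 : ‖t - x‖ < 2 * (2 * s) := by rwa [← dist_eq_norm]
        have h2 : t ∈ closedBall y (1 / 4) := by
          rw [mem_closedBall, dist_eq_norm]
          have := norm_sub_le_norm_sub_add_norm_sub t x y
          linarith
        have h3 := mul_le_mul_of_nonneg_right (hmax' t h2) (K.φ_nonneg ((2 * s)⁻¹ • (x - t)))
        simp only
        nlinarith
      · simp only [kernel_eq_zero K.φ_supp (show 0 < 2 * s by positivity) ht, mul_zero, add_zero,
          le_refl]
    rw [integral_add (i2.const_mul _) (i3.const_mul a), integral_const_mul, integral_const_mul]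
      at hle
    have h5 := K.integral_φ_rescale (show 0 < 2 * s by positivity) x
    have h6 := K.avg_norm_sq_le (show 0 < 2 * s by positivity) x y
    have h7 : K.U u (2 * s) x ≤ (u x - a * ‖x - y‖ ^ 2) +
        a * avg (fun t => ‖t - y‖ ^ 2) K.φ (2 * s) x := by
      calc K.U u (2 * s) x = ((2 * s) ^ N)⁻¹ * ∫ t, u t * K.φ ((2 * s)⁻¹ • (x - t)) := rfl
        _ ≤ ((2 * s) ^ N)⁻¹ * ((u x - a * ‖x - y‖ ^ 2) * (∫ t, K.φ ((2 * s)⁻¹ • (x - t))) +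
            a * ∫ t, ‖t - y‖ ^ 2 * K.φ ((2 * s)⁻¹ • (x - t))) := by gcongr
        _ = (u x - a * ‖x - y‖ ^ 2) * (((2 * s) ^ N)⁻¹ * ∫ t, K.φ ((2 * s)⁻¹ • (x - t))) +
            a * (((2 * s) ^ N)⁻¹ * ∫ t, ‖t - y‖ ^ 2 * K.φ ((2 * s)⁻¹ • (x - t))) := by ring
        _ = _ := by rw [h5, mul_one]; rfl
    have ha0 : 0 < a := by positivity
    have h8 := mul_le_mul_of_nonneg_left h6 ha0.le
    have hs0 : 0 < s ^ 2 * I := by positivity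
    have h9 : s ^ 2 * I ≤ a * (2 * (2 * s)) ^ 2 := by
      linarith [mul_add a (‖x - y‖ ^ 2) ((2 * (2 * s)) ^ 2)]
    rw [ha] at h9
    nlinarith
  · rw [heq] at hwx
    linarith

end MemP

end LowerBound

section Auxiliary

variable {N : ℕ}

/-- The volume of a set which is thin in two directions. -/
theorem volume_real_le_of_thin (b : OrthonormalBasis (Fin N) ℝ (EuclideanSpace ℝ (Fin N)))
    {i j : Fin N} (hij : i ≠ j) (x : EuclideanSpace ℝ (Fin N)) {s t : ℝ} (hs : 0 ≤ s) (ht : 0 ≤ t)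
    {S : Set (EuclideanSpace ℝ (Fin N))} (hS : S ⊆ ball x s)
    (hi : ∀ y ∈ S, |⟪b i, y - x⟫| ≤ t) (hj : ∀ y ∈ S, |⟪b j, y - x⟫| ≤ t) :
    volume.real S ≤ (2 * t) ^ 2 * (2 * s) ^ (N - 2) := by
  set c : Fin N → ℝ := fun m => if m = i ∨ m = j then t else s with hc
  have hc0 : ∀ m, 0 ≤ c m := fun m => by simp only [hc]; split_ifs <;> assumption
  set p : EuclideanSpace ℝ (Fin N) → Fin N → ℝ := fun y => WithLp.ofLp (b.repr y) with hp
  have hpm : MeasurePreserving p volume volume :=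
    (PiLp.volume_preserving_ofLp (Fin N)).comp b.measurePreserving_repr
  set box : Set (Fin N → ℝ) := Icc (fun m => p x m - c m) (fun m => p x m + c m) with hbox
  have hsub : S ⊆ p ⁻¹' box := by
    intro y hy
    have key : ∀ m, |⟪b m, y - x⟫| ≤ c m := by
      intro m
      simp only [hc]
      split_ifs with h
      · rcases h with rfl | rfl
        · exact hi y hy
        · exact hj y hy
      · refine (abs_real_inner_le_norm _ _).trans ?_
        rw [b.norm_eq_one, one_mul, ← dist_eq_norm]
        exact (hS hy).le
    have key2 : ∀ m, |p y m - p x m| ≤ c m := by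
      intro m
      have := key m
      simpa [hp, b.repr_apply_apply, inner_sub_right] using this
    simp only [hbox, mem_preimage, mem_Icc, Pi.le_def]
    exact ⟨fun m => by linarith [(abs_le.1 (key2 m)).1], fun m => by
      linarith [(abs_le.1 (key2 m)).2]⟩
  have hvol : volume.real (p ⁻¹' box) = ∏ m, (2 * c m) := by
    rw [Measure.real, hpm.measure_preimage measurableSet_Icc.nullMeasurableSet,
      Real.volume_Icc_pi_toReal]
    · exact Finset.prod_congr rfl fun m _ => by ring
    · intro m; linarith [hc0 m]
  have hfin : volume (p ⁻¹' box) ≠ ⊤ := by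
    rw [hpm.measure_preimage measurableSet_Icc.nullMeasurableSet]
    exact isCompact_Icc.measure_lt_top.ne
  refine (measureReal_mono hsub hfin).trans (le_of_eq ?_)
  have hfilter : Finset.univ.filter (fun m => m = i ∨ m = j) = {i, j} := by
    ext m; simp
  have hfilter' : Finset.univ.filter (fun m => ¬ (m = i ∨ m = j)) = ({i, j} : Finset (Fin N))ᶜ := by
    ext m; simp
  rw [hvol, show (fun m => 2 * c m) = fun m => if m = i ∨ m = j then 2 * t else 2 * s by
    funext m; simp only [hc]; split_ifs <;> rfl, Finset.prod_ite, hfilter, hfilter',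
    Finset.prod_const, Finset.prod_const, Finset.card_compl, Finset.card_pair hij, Fintype.card_fin]

/-- A two-sided geometric sum. -/
theorem sum_min_le {a t : ℝ} (ha : 0 < a) (ht : 0 < t) (n : ℕ) :
    ∑ m ∈ Finset.range n, min (a / 2 ^ m) (t ^ 2 / (a / 2 ^ m)) ≤ 6 * t := by
  have key : ∀ a : ℝ, 0 < a →
      min a (t ^ 2 / a) ≤ 6 * (t * a / (a + t)) - 6 * (t * (a / 2) / (a / 2 + t)) := by
    intro a ha
    have e : 6 * (t * a / (a + t)) - 6 * (t * (a / 2) / (a / 2 + t)) =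
        6 * t ^ 2 * a / ((a + t) * (a + 2 * t)) := by
      field_simp; ring
    rw [e]
    rcases le_total a t with h | h
    · refine (min_le_left _ _).trans ?_
      rw [le_div_iff₀ (by positivity)]
      have : (a + t) * (a + 2 * t) ≤ 6 * t ^ 2 := by nlinarith
      nlinarith
    · refine (min_le_right _ _).trans ?_
      rw [div_le_div_iff₀ ha (by positivity)]
      have : (a + t) * (a + 2 * t) ≤ 6 * a ^ 2 := by nlinarith
      nlinarith [sq_nonneg t]
  have h1 : ∑ m ∈ Finset.range n, min (a / 2 ^ m) (t ^ 2 / (a / 2 ^ m)) ≤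
      6 * (t * a / (a + t)) - 6 * (t * (a / 2 ^ n) / (a / 2 ^ n + t)) := by
    induction n with
    | zero => simp
    | succ n ih =>
      rw [Finset.sum_range_succ]
      have := key (a / 2 ^ n) (by positivity)
      rw [show a / 2 ^ n / 2 = a / 2 ^ (n + 1) by rw [pow_succ]; field_simp] at this
      linarith
  have h2 : 0 ≤ t * (a / 2 ^ n) / (a / 2 ^ n + t) := by positivity
  have h3 : t * a / (a + t) ≤ t := by
    rw [div_le_iff₀ (by positivity)]; nlinarith
  linarith

/-- A large symmetric form of bounded trace is nondegenerate in at least two directions. -/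
theorem exists_orthonormalBasis_abs_inner_le (hN : 1 ≤ N)
    {A : EuclideanSpace ℝ (Fin N) →L[ℝ] EuclideanSpace ℝ (Fin N) →L[ℝ] ℝ}
    (hsymm : ∀ v w, A v w = A w v)
    (htr : ∑ i : Fin N, A (EuclideanSpace.single i 1) (EuclideanSpace.single i 1) ∈ Icc (0 : ℝ) 1)
    {κ : ℝ} (hκ : 2 ≤ κ) (hA : κ ≤ ‖A‖) :
    ∃ (b : OrthonormalBasis (Fin N) ℝ (EuclideanSpace ℝ (Fin N))) (i j : Fin N), i ≠ j ∧
      ∀ v, |⟪b i, v⟫| ≤ 2 * N / κ * ‖A v‖ ∧ |⟪b j, v⟫| ≤ 2 * N / κ * ‖A v‖ := by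
  set E := EuclideanSpace ℝ (Fin N)
  set T : E →ₗ[ℝ] E := (InnerProductSpace.toDual ℝ E).symm.toLinearEquiv.toLinearMap ∘ₗ A with hT
  have hTi : ∀ v w, ⟪T v, w⟫ = A v w := fun v w => by simp [hT]
  have hTn : ∀ v, ‖T v‖ = ‖A v‖ := fun v => (InnerProductSpace.toDual ℝ E).symm.norm_map (A v)
  have hTs : T.IsSymmetric := fun v w => by
    rw [hTi, real_inner_comm, hTi, hsymm]
  have hn : Module.finrank ℝ E = N := by simp [E]
  set b := hTs.eigenvectorBasis hn with hb
  set l := hTs.eigenvalues hn with hl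
  have hbl : ∀ i v, ⟪b i, T v⟫ = l i * ⟪b i, v⟫ := by
    intro i v
    rw [← hTs, hTs.apply_eigenvectorBasis hn i, real_inner_smul_left]
    rfl
  have htrace : ∑ i, l i ∈ Icc (0 : ℝ) 1 := by
    have h1 := LinearMap.trace_eq_sum_inner T (EuclideanSpace.basisFun (Fin N) ℝ)
    have h2 := LinearMap.trace_eq_sum_inner T b
    rw [h1] at h2
    have h3 : ∀ i, ⟪EuclideanSpace.basisFun (Fin N) ℝ i, T (EuclideanSpace.basisFun (Fin N) ℝ i)⟫ =
        A (EuclideanSpace.single i 1) (EuclideanSpace.single i 1) := by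
      intro i
      rw [real_inner_comm, hTi, EuclideanSpace.basisFun_apply]
    have h4 : ∀ i, ⟪b i, T (b i)⟫ = l i := by
      intro i
      rw [hbl, real_inner_self_eq_norm_sq, b.norm_eq_one]; simp
    simp only [h3, h4] at h2
    rwa [h2] at htr
  have : Nonempty (Fin N) := ⟨⟨0, hN⟩⟩
  obtain ⟨i, -, hi⟩ := Finset.exists_max_image Finset.univ (fun i => |l i|) Finset.univ_nonempty
  have hκi : κ ≤ |l i| := by
    refine hA.trans (ContinuousLinearMap.opNorm_le_bound _ (abs_nonneg _) fun v => ?_)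
    rw [← hTn]
    refine le_of_sq_le_sq ?_ (by positivity)
    rw [← b.sum_sq_norm_inner_right, mul_pow, ← b.sum_sq_norm_inner_right v, Finset.mul_sum]
    refine Finset.sum_le_sum fun m _ => ?_
    rw [hbl, norm_mul, mul_pow]
    have := hi m (Finset.mem_univ m)
    rw [Real.norm_eq_abs (l m)]
    gcongr
  have hN0 : (1 : ℝ) ≤ N := by exact_mod_cast hN
  obtain ⟨j, hji, hj⟩ : ∃ j, j ≠ i ∧ (κ - 1) / N ≤ |l j| := by
    by_contra! hcon
    have h1 : l i + ∑ j ∈ Finset.univ.erase i, l j = ∑ j, l j :=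
      Finset.add_sum_erase _ _ (Finset.mem_univ i)
    have h2 : |∑ j ∈ Finset.univ.erase i, l j| ≤ (N - 1) * ((|l i| - 1) / N) := by
      calc _ ≤ ∑ j ∈ Finset.univ.erase i, |l j| := Finset.abs_sum_le_sum_abs _ _
        _ ≤ ∑ j ∈ Finset.univ.erase i, (|l i| - 1) / N := by
            refine Finset.sum_le_sum fun j hj => ?_
            refine (hcon j (Finset.ne_of_mem_erase hj)).le.trans ?_
            gcongr
        _ = _ := by
            rw [Finset.sum_const, Finset.card_erase_of_mem (Finset.mem_univ i), Finset.card_univ,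
              Fintype.card_fin, nsmul_eq_mul, Nat.cast_sub hN, Nat.cast_one]
    have h3 : |l i| ≤ 1 + |∑ j ∈ Finset.univ.erase i, l j| := by
      have : l i = (∑ j, l j) - ∑ j ∈ Finset.univ.erase i, l j := by linarith
      rw [this]
      refine (abs_sub _ _).trans ?_
      gcongr
      rw [abs_of_nonneg htrace.1]
      exact htrace.2
    have h4 : (N - 1) * ((|l i| - 1) / N) < |l i| - 1 := by
      rw [mul_div_assoc', div_lt_iff₀ (by linarith)]
      nlinarith
    linarith
  have key : ∀ m v, κ / (2 * N) ≤ |l m| → |⟪b m, v⟫| ≤ 2 * N / κ * ‖A v‖ := by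
    intro m v hm
    have h1 : |l m| * |⟪b m, v⟫| ≤ ‖A v‖ := by
      rw [← abs_mul, ← hbl, ← hTn]
      refine (abs_real_inner_le_norm _ _).trans ?_
      rw [b.norm_eq_one, one_mul]
    have h2 := (mul_le_mul_of_nonneg_right hm (abs_nonneg ⟪b m, v⟫)).trans h1
    calc |⟪b m, v⟫| = 2 * N / κ * (κ / (2 * N) * |⟪b m, v⟫|) := by field_simp
      _ ≤ _ := by gcongr
  refine ⟨b, i, j, hji.symm, fun v => ⟨key i v (le_trans ?_ hκi), key j v (le_trans ?_ hj)⟩⟩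
  · exact div_le_self (by linarith) (by linarith)
  · rw [div_le_div_iff₀ (by positivity) (by positivity)]
    nlinarith

end Auxiliary

section Scales

variable {N : ℕ}

/-- The dyadic scales. -/
def scale (k : ℕ) : ℝ := 1 / (32 * 2 ^ k)

theorem scale_pos (k : ℕ) : 0 < scale k := by unfold scale; positivity

theorem two_mul_scale_succ (k : ℕ) : 2 * scale (k + 1) = scale k := by
  unfold scale; rw [pow_succ]; field_simp

theorem scale_add (k m : ℕ) : scale (k + m) = scale k / 2 ^ m := by
  unfold scale; rw [pow_add]; field_simp

theorem scale_zero : scale 0 = 1 / 32 := by simp [scale]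

theorem scale_anti : Antitone scale := antitone_nat_of_succ_le fun k => by
  linarith [two_mul_scale_succ k, scale_pos (k + 1)]

theorem scale_le (k : ℕ) : scale k ≤ 1 / 32 := scale_zero ▸ scale_anti (Nat.zero_le k)

theorem inv_scale (k : ℕ) : (scale k)⁻¹ = 32 * 2 ^ k := by simp [scale]

theorem tendsto_scale_add (k : ℕ) :
    Tendsto (fun n => scale (k + n)) atTop (nhdsWithin 0 (Ioi 0)) := by
  simp only [scale_add]
  exact tendsto_div_two_pow (scale_pos k)

theorem DyadicKernel.tendsto_P_apply (K : DyadicKernel N) {u : EuclideanSpace ℝ (Fin N) → ℝ}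
    (hu : ContDiff ℝ 1 u) (k : ℕ) (x v : EuclideanSpace ℝ (Fin N)) :
    Tendsto (fun n => K.P u (scale (k + n)) x v) atTop (nhds (fderiv ℝ u x v)) := by
  refine ((K.tendsto_avg (w := fun t => fderiv ℝ u t v)
    ((hu.continuous_fderiv (by simp)).clm_apply continuous_const) x).comp
    (tendsto_scale_add k)).congr fun n => ?_
  exact (K.P_apply hu (scale_pos _) x v).symm

/-- Uniform bounds for the kernels and for the volume of balls. -/
structure DyadicKernel.Bounds (K : DyadicKernel N) (L V : ℝ) : Prop where
  L_nonneg : 0 ≤ L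
  V_nonneg : 0 ≤ V
  ddφ_le : ∀ v, ‖fderiv ℝ (fderiv ℝ K.φ) v‖ ≤ L
  dφ_taylor : ∀ a b, ‖fderiv ℝ K.φ a - fderiv ℝ K.φ b - fderiv ℝ (fderiv ℝ K.φ) b (a - b)‖ ≤
    L * ‖a - b‖ ^ 2
  dΨ_le : ∀ v, ‖fderiv ℝ K.Ψ v‖ ≤ L
  ddΨ_le : ∀ v, ‖fderiv ℝ (fderiv ℝ K.Ψ) v‖ ≤ L
  dΨ_taylor : ∀ a b, ‖fderiv ℝ K.Ψ a - fderiv ℝ K.Ψ b - fderiv ℝ (fderiv ℝ K.Ψ) b (a - b)‖ ≤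
    L * ‖a - b‖ ^ 2
  volume_le : ∀ (x : EuclideanSpace ℝ (Fin N)) (r : ℝ), 0 < r →
    (r ^ N)⁻¹ * volume.real (ball x (6 * r)) ≤ V

theorem volume_real_ball_mul (x : EuclideanSpace ℝ (Fin N)) {r : ℝ} (hr : 0 < r) (s : ℝ) :
    volume.real (ball x (s * r)) = r ^ N * volume.real (ball (0 : EuclideanSpace ℝ (Fin N)) s) := by
  rw [mul_comm, Measure.real, Measure.addHaar_ball_mul_of_pos _ _ hr, ENNReal.toReal_mul,
    finrank_euclideanSpace, Fintype.card_fin, ENNReal.toReal_ofReal (by positivity)]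
  rfl

theorem DyadicKernel.exists_bounds (K : DyadicKernel N) : ∃ L V, K.Bounds L V := by
  obtain ⟨L1, h10, h11, h12, h13⟩ := exists_kernel_bound K.dφ_smooth K.dφ_supp
  obtain ⟨L2, h20, h21, h22, h23⟩ := exists_kernel_bound K.dΨ_smooth K.dΨ_supp
  have e1 : L1 ≤ L1 + L2 := by linarith
  have e2 : L2 ≤ L1 + L2 := by linarith
  refine ⟨L1 + L2, volume.real (ball (0 : EuclideanSpace ℝ (Fin N)) 6), by positivity,
    measureReal_nonneg, fun v => (h12 v).trans e1, fun a b => (h13 a b).trans (by gcongr),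
    fun v => (h21 v).trans e2, fun v => (h22 v).trans e2,
    fun a b => (h23 a b).trans (by gcongr), fun x r hr => ?_⟩
  rw [volume_real_ball_mul x hr, inv_mul_cancel_left₀ (by positivity)]

/-- The density of the complement of `Ω` in the ball of radius `s * r`, in units of `r`. -/
def dens (Ω : Set (EuclideanSpace ℝ (Fin N))) (x : EuclideanSpace ℝ (Fin N)) (s r : ℝ) : ℝ :=
  (r ^ N)⁻¹ * volume.real (Ωᶜ ∩ ball x (s * r))

variable {Ω : Set (EuclideanSpace ℝ (Fin N))} {K : DyadicKernel N} {L V : ℝ}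

theorem volume_compl_inter_ball_ne_top (Ω : Set (EuclideanSpace ℝ (Fin N)))
    (x : EuclideanSpace ℝ (Fin N)) (s : ℝ) : volume (Ωᶜ ∩ ball x s) ≠ ⊤ :=
  measure_ne_top_of_subset inter_subset_right measure_ball_lt_top.ne

theorem dens_nonneg (x : EuclideanSpace ℝ (Fin N)) (s : ℝ) {r : ℝ} (hr : 0 < r) :
    0 ≤ dens Ω x s r := by unfold dens; positivity

theorem dens_le (hb : K.Bounds L V) (x : EuclideanSpace ℝ (Fin N)) {s r : ℝ} (hr : 0 < r)
    (hs : s ≤ 6) : dens Ω x s r ≤ V := by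
  refine le_trans ?_ (hb.volume_le x r hr)
  unfold dens
  gcongr
  · exact measure_ball_lt_top.ne
  · exact inter_subset_right.trans (ball_subset_ball (by gcongr))

theorem abs_coind_le_indicator {S T : Set (EuclideanSpace ℝ (Fin N))} (hST : T ⊆ S)
    (y : EuclideanSpace ℝ (Fin N)) (hy : y ∈ T) :
    |coind Ω y| ≤ (Ωᶜ ∩ S).indicator (fun _ => 1) y := by
  by_cases h : y ∈ Ωᶜ
  · rw [coind, indicator_of_mem h, indicator_of_mem (show y ∈ Ωᶜ ∩ S from ⟨h, hST hy⟩), abs_one]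
  · rw [coind, indicator_of_notMem h, abs_zero]
    exact indicator_nonneg (fun _ _ => zero_le_one) _

theorem norm_avg_coind_le {F : Type*} [NormedAddCommGroup F] [NormedSpace ℝ F] (hΩ : IsOpen Ω)
    {κ : EuclideanSpace ℝ (Fin N) → F} (hs : tsupport κ ⊆ ball 0 2)
    (hL : ∀ v, ‖κ v‖ ≤ L) {r : ℝ} (hr : 0 < r) (x : EuclideanSpace ℝ (Fin N)) :
    ‖avg (coind Ω) κ r x‖ ≤ L * dens Ω x 2 r := by
  have := norm_avg_le hs hL hr zero_le_one
    (hΩ.measurableSet.compl.inter measurableSet_ball)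
    (volume_compl_inter_ball_ne_top Ω x (2 * r)) (fun y hy => abs_coind_le_indicator subset_rfl y hy)
  rwa [mul_one] at this

end Scales

section Expansion

variable {N : ℕ} {K : DyadicKernel N} {L V : ℝ} {z : EuclideanSpace ℝ (Fin N)} {M : ℝ}
  {Ω : Set (EuclideanSpace ℝ (Fin N))} {u : EuclideanSpace ℝ (Fin N) → ℝ}

namespace MemP

theorem norm_P_sub_le (h : MemP N 1 z M Ω u) (hb : K.Bounds L V) {x : EuclideanSpace ℝ (Fin N)}
    (hx : ‖x - z‖ < 15 / 16) (k : ℕ) :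
    ‖K.P u (scale k) x - K.P u (scale (k + 1)) x‖ ≤
      L * (scale (k + 1) * dens Ω x 2 (scale (k + 1))) := by
  have hk := scale_pos (k + 1)
  have := h.P_step K hk (x := x) (by linarith [scale_le (k + 1)])
  rw [two_mul_scale_succ] at this
  rw [this, norm_neg, norm_smul, Real.norm_of_nonneg hk.le]
  calc _ ≤ scale (k + 1) * (L * dens Ω x 2 (scale (k + 1))) := by
        gcongr; exact norm_avg_coind_le h.isOpen K.dΨ_supp hb.dΨ_le hk x
    _ = _ := by ring

theorem norm_Q_sub_le (h : MemP N 1 z M Ω u) (hb : K.Bounds L V) {x : EuclideanSpace ℝ (Fin N)}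
    (hx : ‖x - z‖ < 15 / 16) (k : ℕ) :
    ‖K.Q u (scale k) x - K.Q u (scale (k + 1)) x‖ ≤ L * dens Ω x 2 (scale (k + 1)) := by
  have hk := scale_pos (k + 1)
  have := h.Q_step K hk (x := x) (by linarith [scale_le (k + 1)])
  rw [two_mul_scale_succ] at this
  rw [this]
  refine (ContinuousLinearMap.opNorm_neg _).trans_le
    (norm_avg_coind_le h.isOpen (κ := fderiv ℝ (fderiv ℝ K.Ψ)) ?_ ?_ hk x)
  · exact K.ddΨ_supp
  · exact hb.ddΨ_le

theorem _root_.norm_smul_smul_avg_le {F : Type*} [NormedAddCommGroup F] [NormedSpace ℝ F]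
    {κ : EuclideanSpace ℝ (Fin N) → F} (hs : tsupport κ ⊆ ball 0 2) (hκ : ∀ v, ‖κ v‖ ≤ L)
    (hb : K.Bounds L V) {x : EuclideanSpace ℝ (Fin N)} {m r : ℝ} (hr : 0 < r) (hm : 0 ≤ m)
    (hu : ∀ y ∈ ball x (2 * r), |u y| ≤ m) :
    ‖r⁻¹ • r⁻¹ • avg u κ r x‖ ≤ r⁻¹ ^ 2 * (L * m * V) := by
  have h1 := norm_avg_le hs hκ hr hm (x := x) (w := u) (S := ball x (2 * r))
    measurableSet_ball measure_ball_lt_top.ne (fun y hy => by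
      rw [indicator_of_mem hy]; exact hu y hy)
  have h2 : (r ^ N)⁻¹ * volume.real (ball x (2 * r)) ≤ V := by
    refine le_trans ?_ (hb.volume_le x _ hr)
    gcongr
    · exact measure_ball_lt_top.ne
    · norm_num
  have hL := hb.L_nonneg
  rw [norm_smul, norm_smul, norm_inv, Real.norm_of_nonneg hr.le, ← mul_assoc, ← sq]
  gcongr
  exact h1.trans (by gcongr)

/-- Bound of the second derivative at scale `k` by the supremum of `u`. -/
theorem _root_.DyadicKernel.Bounds.norm_Q_le (hb : K.Bounds L V) {x : EuclideanSpace ℝ (Fin N)}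
    {m : ℝ} (hm : 0 ≤ m) (k : ℕ) (hu : ∀ y ∈ ball x (2 * scale k), |u y| ≤ m) :
    ‖K.Q u (scale k) x‖ ≤ (scale k)⁻¹ ^ 2 * (L * m * V) := by
  refine norm_smul_smul_avg_le (κ := fderiv ℝ (fderiv ℝ K.φ)) ?_ ?_ hb (scale_pos k) hm hu
  · exact K.ddφ_supp
  · exact hb.ddφ_le

variable {y : EuclideanSpace ℝ (Fin N)}

/-- The weighted sum of densities controlling the Taylor remainder. -/
def _root_.densSum (Ω : Set (EuclideanSpace ℝ (Fin N))) (y : EuclideanSpace ℝ (Fin N)) (M : ℝ)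
    (k : ℕ) : ℝ :=
  M + ∑ i ∈ Finset.range k, 2 ^ (i + 1) * dens Ω y 4 (scale i)

theorem norm_P_taylor_le (h : MemP N 1 z M Ω u) (hb : K.Bounds L V) (hM : 0 ≤ M)
    (hyz : ‖y - z‖ ≤ 3 / 4) {x : EuclideanSpace ℝ (Fin N)} (k : ℕ)
    (hx : ‖x - y‖ < 4 * scale k) :
    ‖K.P u (scale k) x - K.P u (scale k) y - K.Q u (scale k) y (x - y)‖ ≤
      32 ^ 3 * L * (V + 2 ^ N) * ‖x - y‖ ^ 2 * densSum Ω y M k := by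
  have hL := hb.L_nonneg
  have hV := hb.V_nonneg
  induction k with
  | zero =>
    have hk := scale_pos 0
    have h1 := norm_avg_taylor_le h.continuous.locallyIntegrable (K.dφ_smooth.of_le (by simp))
      K.dφ_supp hb.dφ_taylor hL hk hM (x := x) (x' := y) (S := ball y (6 * scale 0))
      measurableSet_ball measure_ball_lt_top.ne (fun t ht => by
        have hty : dist t y < 6 * scale 0 := by
          rcases ht with ht | ht
          · have := dist_triangle t x y
            rw [dist_eq_norm x y] at this
            have ht' : dist t x < 2 * scale 0 := ht
            linarith
          · have ht' : dist t y < 2 * scale 0 := ht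
            linarith
        rw [indicator_of_mem (show t ∈ ball y (6 * scale 0) from hty)]
        refine h.abs_le ?_
        rw [mem_ball]
        have := dist_triangle t y z
        rw [dist_eq_norm y z] at this
        rw [scale_zero] at hty
        linarith)
    have h2 := hb.volume_le y _ hk
    have e : K.P u (scale 0) x - K.P u (scale 0) y - K.Q u (scale 0) y (x - y) =
        (scale 0)⁻¹ • (avg u (fderiv ℝ K.φ) (scale 0) x - avg u (fderiv ℝ K.φ) (scale 0) y -
          ((scale 0)⁻¹ • avg u (fderiv ℝ (fderiv ℝ K.φ)) (scale 0) y) (x - y)) := by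
      rw [smul_sub, smul_sub]; rfl
    rw [e, norm_smul, norm_inv, Real.norm_of_nonneg hk.le]
    calc _ ≤ (scale 0)⁻¹ * (L * M * (‖x - y‖ / scale 0) ^ 2 * V) := by
          gcongr
          exact h1.trans (by gcongr)
      _ = 32 ^ 3 * L * V * ‖x - y‖ ^ 2 * M := by rw [scale_zero]; ring
      _ ≤ _ := by
        simp only [densSum, Finset.range_zero, Finset.sum_empty, add_zero]
        gcongr
        exact le_add_of_nonneg_right (by positivity)
  | succ k ih =>
    have hk := scale_pos (k + 1)
    have h2k := two_mul_scale_succ k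
    have ih' := ih (by linarith)
    have hxz : ‖x - z‖ < 15 / 16 := by
      have := norm_sub_le_norm_sub_add_norm_sub x y z
      linarith [scale_le (k + 1)]
    have hxP := h.P_step K hk (x := x) (by linarith [scale_le (k + 1)])
    have hyP := h.P_step K hk (x := y) (by linarith [scale_le (k + 1)])
    have hyQ := h.Q_step K hk (x := y) (by linarith [scale_le (k + 1)])
    rw [h2k] at hxP hyP hyQ
    have h1 := norm_avg_taylor_le (locallyIntegrable_coind h.isOpen)
      (K.dΨ_smooth.of_le (by simp)) K.dΨ_supp hb.dΨ_taylor hL hk zero_le_one (x := x) (x' := y)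
      (h.isOpen.measurableSet.compl.inter measurableSet_ball)
      (volume_compl_inter_ball_ne_top Ω y (4 * scale k))
      (abs_coind_le_indicator (fun t ht => by
        rw [mem_ball]
        rcases ht with ht | ht
        · have := dist_triangle t x y
          rw [dist_eq_norm x y] at this
          have ht' : dist t x < 2 * scale (k + 1) := ht
          linarith
        · have ht' : dist t y < 2 * scale (k + 1) := ht
          linarith))
    have e : K.P u (scale (k + 1)) x - K.P u (scale (k + 1)) y - K.Q u (scale (k + 1)) y (x - y) =
        (K.P u (scale k) x - K.P u (scale k) y - K.Q u (scale k) y (x - y)) +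
        scale (k + 1) • (avg (coind Ω) (fderiv ℝ K.Ψ) (scale (k + 1)) x -
          avg (coind Ω) (fderiv ℝ K.Ψ) (scale (k + 1)) y -
          ((scale (k + 1))⁻¹ • avg (coind Ω) (fderiv ℝ (fderiv ℝ K.Ψ)) (scale (k + 1)) y)
            (x - y)) := by
      rw [sub_eq_iff_eq_add] at hxP hyP
      have hyQ' := congrArg (fun A => A (x - y)) hyQ
      simp only [sub_apply, neg_apply] at hyQ'
      rw [sub_eq_iff_eq_add] at hyQ'
      rw [hxP, hyP, hyQ', smul_apply, smul_sub, smul_sub, smul_smul, mul_inv_cancel₀ hk.ne',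
        one_smul]
      abel
    have hN2 : ((scale (k + 1)) ^ N)⁻¹ * volume.real (Ωᶜ ∩ ball y (4 * scale k)) =
        2 ^ N * dens Ω y 4 (scale k) := by
      rw [dens, ← h2k, mul_pow, mul_inv, mul_assoc ((2 : ℝ) ^ N)⁻¹, mul_inv_cancel_left₀
        (by positivity)]
    rw [hN2] at h1
    have hstep : ‖scale (k + 1) • (avg (coind Ω) (fderiv ℝ K.Ψ) (scale (k + 1)) x -
          avg (coind Ω) (fderiv ℝ K.Ψ) (scale (k + 1)) y -
          ((scale (k + 1))⁻¹ • avg (coind Ω) (fderiv ℝ (fderiv ℝ K.Ψ)) (scale (k + 1)) y)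
            (x - y))‖ ≤
        32 ^ 3 * L * (V + 2 ^ N) * ‖x - y‖ ^ 2 * (2 ^ (k + 1) * dens Ω y 4 (scale k)) := by
      have hd := dens_nonneg (Ω := Ω) y 4 (scale_pos k)
      rw [norm_smul, Real.norm_of_nonneg hk.le]
      calc _ ≤ scale (k + 1) * (L * 1 * (‖x - y‖ / scale (k + 1)) ^ 2 *
            (2 ^ N * dens Ω y 4 (scale k))) := by gcongr
        _ = (scale (k + 1))⁻¹ * L * 2 ^ N * ‖x - y‖ ^ 2 * dens Ω y 4 (scale k) := by
          field_simp
        _ = 32 * L * 2 ^ N * ‖x - y‖ ^ 2 * (2 ^ (k + 1) * dens Ω y 4 (scale k)) := by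
          rw [inv_scale]; ring
        _ ≤ _ := by
          gcongr
          · norm_num
          · exact le_add_of_nonneg_left hV
    rw [e]
    refine (norm_add_le _ _).trans ((add_le_add ih' hstep).trans (le_of_eq ?_))
    rw [densSum, densSum, Finset.sum_range_succ]
    ring

/-- First order expansion of the gradient at a point where it vanishes. -/
theorem norm_fderiv_sub_Q_le (h : MemP N 1 z M Ω u) (hb : K.Bounds L V) (hM : 0 ≤ M)
    (hyz : ‖y - z‖ ≤ 3 / 4) (hy : y ∉ Ω) {x : EuclideanSpace ℝ (Fin N)} (k : ℕ)
    (hx : ‖x - y‖ < 4 * scale k) {B : ℝ}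
    (hB : ∀ n, ∑ m ∈ Finset.range n, scale (k + 1 + m) *
      (dens Ω x 2 (scale (k + 1 + m)) + dens Ω y 2 (scale (k + 1 + m))) ≤ B) :
    ‖fderiv ℝ u x - K.Q u (scale k) y (x - y)‖ ≤
      L * B + 32 ^ 3 * L * (V + 2 ^ N) * ‖x - y‖ ^ 2 * densSum Ω y M k := by
  have hL := hb.L_nonneg
  have hxz : ‖x - z‖ < 15 / 16 := by
    have := norm_sub_le_norm_sub_add_norm_sub x y z
    linarith [scale_le k]
  have hT := h.norm_P_taylor_le hb hM hyz k hx
  set T := 32 ^ 3 * L * (V + 2 ^ N) * ‖x - y‖ ^ 2 * densSum Ω y M k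
  have hyb : y ∈ ball z 1 := by rw [mem_ball, dist_eq_norm]; linarith
  have hsum : ∀ n, ‖K.P u (scale (k + n)) x - K.P u (scale (k + n)) y -
      K.Q u (scale k) y (x - y)‖ ≤ L * ∑ m ∈ Finset.range n, scale (k + 1 + m) *
      (dens Ω x 2 (scale (k + 1 + m)) + dens Ω y 2 (scale (k + 1 + m))) + T := by
    intro n
    induction n with
    | zero => simpa using hT
    | succ n ih =>
      have h1 := h.norm_P_sub_le hb hxz (k + n)
      have h2 := h.norm_P_sub_le hb (x := y) (by linarith) (k + n)
      rw [Finset.sum_range_succ, show k + (n + 1) = k + n + 1 by ring,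
        show k + 1 + n = k + n + 1 by ring]
      have e : K.P u (scale (k + n + 1)) x - K.P u (scale (k + n + 1)) y -
          K.Q u (scale k) y (x - y) = (K.P u (scale (k + n)) x - K.P u (scale (k + n)) y -
          K.Q u (scale k) y (x - y)) - (K.P u (scale (k + n)) x - K.P u (scale (k + n + 1)) x) +
          (K.P u (scale (k + n)) y - K.P u (scale (k + n + 1)) y) := by abel
      rw [e]
      refine (norm_add_le _ _).trans ((add_le_add (norm_sub_le _ _) le_rfl).trans ?_)
      linarith
  have hle : ∀ n, ‖K.P u (scale (k + n)) x - K.P u (scale (k + n)) y -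
      K.Q u (scale k) y (x - y)‖ ≤ L * B + T :=
    fun n => (hsum n).trans (by gcongr; exact hB n)
  refine ContinuousLinearMap.opNorm_le_bound _ ((norm_nonneg _).trans (hle 0)) fun v => ?_
  have hl := (((K.tendsto_P_apply h.contDiff k x v).sub
    (K.tendsto_P_apply h.contDiff k y v)).sub_const (K.Q u (scale k) y (x - y) v)).norm
  rw [h.fderiv_eq_zero hyb hy, zero_apply, sub_zero] at hl
  refine le_of_tendsto hl (Eventually.of_forall fun n => ?_)
  exact ((K.P u (scale (k + n)) x - K.P u (scale (k + n)) y -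
    K.Q u (scale k) y (x - y)).le_opNorm v).trans (by gcongr; exact hle n)

end MemP

end Expansion

section Tubes

variable {N : ℕ} {K : DyadicKernel N} {L V : ℝ} {z y : EuclideanSpace ℝ (Fin N)} {M : ℝ}
  {Ω : Set (EuclideanSpace ℝ (Fin N))} {u : EuclideanSpace ℝ (Fin N) → ℝ}

/-- At scale `k`, the complement of `Ω` near `y` is thin in two orthogonal directions. -/
def Tube (Ω : Set (EuclideanSpace ℝ (Fin N))) (y : EuclideanSpace ℝ (Fin N)) (k : ℕ) (τ : ℝ) :
    Prop :=
  ∃ (b : OrthonormalBasis (Fin N) ℝ (EuclideanSpace ℝ (Fin N))) (i j : Fin N), i ≠ j ∧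
    ∀ x ∈ Ωᶜ, ‖x - y‖ < 4 * scale k →
      |⟪b i, x - y⟫| ≤ τ * scale k ∧ |⟪b j, x - y⟫| ≤ τ * scale k

namespace Tube

theorem mono {k : ℕ} {τ τ' : ℝ} (h : Tube Ω y k τ) (hτ : τ ≤ τ') : Tube Ω y k τ' := by
  obtain ⟨b, i, j, hij, hb⟩ := h
  have hk := scale_pos k
  refine ⟨b, i, j, hij, fun x hx hxy => ?_⟩
  obtain ⟨h1, h2⟩ := hb x hx hxy
  exact ⟨h1.trans (by gcongr), h2.trans (by gcongr)⟩

theorem four (hN : 2 ≤ N) (k : ℕ) : Tube Ω y k 4 := by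
  have hb : ∀ (i : Fin N) (v : EuclideanSpace ℝ (Fin N)),
      |⟪EuclideanSpace.basisFun (Fin N) ℝ i, v⟫| ≤ ‖v‖ := fun i v => by
    refine (abs_real_inner_le_norm _ _).trans ?_
    rw [(EuclideanSpace.basisFun (Fin N) ℝ).norm_eq_one, one_mul]
  exact ⟨EuclideanSpace.basisFun (Fin N) ℝ, ⟨0, by omega⟩, ⟨1, by omega⟩, by simp,
    fun x _ hxy => ⟨(hb _ _).trans hxy.le, (hb _ _).trans hxy.le⟩⟩

theorem dens_le (hN : 2 ≤ N) {k : ℕ} {τ : ℝ} (h : Tube Ω y k τ) (h0 : 0 ≤ τ) (h4 : τ ≤ 4) :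
    dens Ω y 4 (scale k) ≤ 8 ^ N * τ := by
  obtain ⟨b, i, j, hij, hb⟩ := h
  have hk := scale_pos k
  have hb' : ∀ x ∈ Ωᶜ ∩ ball y (4 * scale k),
      |⟪b i, x - y⟫| ≤ τ * scale k ∧ |⟪b j, x - y⟫| ≤ τ * scale k :=
    fun x hx => hb x hx.1 (by rw [← dist_eq_norm]; exact hx.2)
  have hv := volume_real_le_of_thin b hij y (s := 4 * scale k) (t := τ * scale k)
    (by positivity) (by positivity) (inter_subset_right (s := Ωᶜ)) (fun x hx => (hb' x hx).1)
    (fun x hx => (hb' x hx).2)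
  obtain ⟨n, rfl⟩ := Nat.exists_eq_add_of_le' hN
  rw [Nat.add_sub_cancel] at hv
  calc dens Ω y 4 (scale k)
      ≤ (scale k ^ (n + 2))⁻¹ * ((2 * (τ * scale k)) ^ 2 * (2 * (4 * scale k)) ^ n) := by
        unfold dens; gcongr
    _ = 4 * 8 ^ n * τ * τ := by
        rw [← mul_assoc 2 4, mul_pow (2 * 4), pow_add]; field_simp; norm_num; ring
    _ ≤ 4 * 8 ^ n * τ * 4 := by gcongr
    _ ≤ 8 ^ (n + 2) * τ := by
        rw [pow_add]; nlinarith [mul_nonneg (pow_nonneg (show (0 : ℝ) ≤ 8 by norm_num) n) h0]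

theorem scale_mul_dens_le (hN : 2 ≤ N) (hbd : K.Bounds L V) {k j : ℕ} {τ : ℝ} (h : Tube Ω y k τ)
    (h0 : 0 < τ) (hj : k + 2 ≤ j) {x : EuclideanSpace ℝ (Fin N)} (hx : x ∈ Ωᶜ)
    (hxy : ‖x - y‖ < 4 * scale (k + 1)) :
    scale j * dens Ω x 2 (scale j) ≤
      (V + 4 ^ N) * min (scale j) ((τ * scale k) ^ 2 / scale j) := by
  obtain ⟨b, i, i', hij, hb⟩ := h
  have hk := scale_pos k
  have hjp := scale_pos j
  have h1 := two_mul_scale_succ k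
  have h2 := two_mul_scale_succ (k + 1)
  have h3 := scale_anti hj
  have hV := hbd.V_nonneg
  obtain ⟨hxi, hxi'⟩ := hb x hx (by linarith)
  have hb' : ∀ t ∈ Ωᶜ ∩ ball x (2 * scale j),
      |⟪b i, t - x⟫| ≤ 2 * (τ * scale k) ∧ |⟪b i', t - x⟫| ≤ 2 * (τ * scale k) := by
    intro t ht
    have htx : ‖t - x‖ < 2 * scale j := by rw [← dist_eq_norm]; exact ht.2
    obtain ⟨hti, hti'⟩ := hb t ht.1 (by
      have := norm_sub_le_norm_sub_add_norm_sub t x y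
      linarith)
    have e : ∀ c, ⟪b c, t - x⟫ = ⟪b c, t - y⟫ - ⟪b c, x - y⟫ := fun c => by
      rw [← inner_sub_right, sub_sub_sub_cancel_right]
    rw [e, e]
    exact ⟨(abs_sub _ _).trans (by linarith), (abs_sub _ _).trans (by linarith)⟩
  have hv := volume_real_le_of_thin b hij x (s := 2 * scale j) (t := 2 * (τ * scale k))
    (by positivity) (by positivity) (inter_subset_right (s := Ωᶜ)) (fun x hx => (hb' x hx).1)
    (fun x hx => (hb' x hx).2)
  have d1 : dens Ω x 2 (scale j) ≤ V := _root_.dens_le hbd x hjp (by norm_num)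
  have d2 : scale j * dens Ω x 2 (scale j) ≤ 4 ^ N * ((τ * scale k) ^ 2 / scale j) := by
    obtain ⟨n, rfl⟩ := Nat.exists_eq_add_of_le' hN
    rw [Nat.add_sub_cancel] at hv
    calc scale j * dens Ω x 2 (scale j) ≤ scale j * ((scale j ^ (n + 2))⁻¹ *
          ((2 * (2 * (τ * scale k))) ^ 2 * (2 * (2 * scale j)) ^ n)) := by unfold dens; gcongr
      _ = _ := by
        rw [← mul_assoc 2 2 (scale j), mul_pow (2 * 2), pow_add, pow_add]; field_simp; norm_num; ring
  rw [mul_min_of_nonneg _ _ (by positivity)]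
  refine le_min ?_ (d2.trans ?_)
  · rw [mul_comm]
    gcongr
    exact d1.trans (le_add_of_nonneg_right (by positivity))
  · gcongr
    exact le_add_of_nonneg_left hV

theorem sum_dens_le (hN : 2 ≤ N) (hbd : K.Bounds L V) {k : ℕ} {τ : ℝ} (h : Tube Ω y k τ)
    (h0 : 0 < τ) (hy : y ∈ Ωᶜ) {x : EuclideanSpace ℝ (Fin N)} (hx : x ∈ Ωᶜ)
    (hxy : ‖x - y‖ < 4 * scale (k + 1)) (n : ℕ) :
    ∑ m ∈ Finset.range n, scale (k + 2 + m) *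
      (dens Ω x 2 (scale (k + 2 + m)) + dens Ω y 2 (scale (k + 2 + m))) ≤
      12 * (V + 4 ^ N) * (τ * scale k) := by
  have hk := scale_pos k
  have hV := hbd.V_nonneg
  have hs := sum_min_le (scale_pos (k + 2)) (show 0 < τ * scale k by positivity) n
  simp only [← scale_add] at hs
  calc _ ≤ ∑ m ∈ Finset.range n, 2 * (V + 4 ^ N) *
        min (scale (k + 2 + m)) ((τ * scale k) ^ 2 / scale (k + 2 + m)) := by
        refine Finset.sum_le_sum fun m _ => ?_
        have h1 := h.scale_mul_dens_le hN hbd h0 (Nat.le_add_right (k + 2) m) hx hxy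
        have h2 := h.scale_mul_dens_le hN hbd h0 (Nat.le_add_right (k + 2) m) hy
          (by rw [sub_self, norm_zero]; linarith [scale_pos (k + 1)])
        linarith
    _ ≤ 2 * (V + 4 ^ N) * (6 * (τ * scale k)) := by
        rw [← Finset.mul_sum]; gcongr
    _ = _ := by ring

theorem succ (hN : 2 ≤ N) (hu : MemP N 1 z M Ω u) (hbd : K.Bounds L V) (hM : 0 ≤ M)
    (hyz : ‖y - z‖ ≤ 3 / 4) (hy : y ∈ Ωᶜ) {k : ℕ} {τ κ : ℝ} (h : Tube Ω y k τ) (h0 : 0 < τ)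
    (hκ : 2 ≤ κ) (hA : κ ≤ ‖K.Q u (scale (k + 1)) y‖) :
    Tube Ω y (k + 1) (2 * N / κ * (24 * L * (V + 4 ^ N) * τ +
      32 ^ 3 * L * (V + 2 ^ N) * (densSum Ω y M (k + 1) / 2 ^ (k + 1)))) := by
  have hk := scale_pos (k + 1)
  have hks := scale_le (k + 1)
  have hL := hbd.L_nonneg
  have hV := hbd.V_nonneg
  have hS : 0 ≤ densSum Ω y M (k + 1) :=
    add_nonneg hM (Finset.sum_nonneg fun i _ =>
      mul_nonneg (by positivity) (dens_nonneg _ _ (scale_pos i)))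
  obtain ⟨b, i, j, hij, hb⟩ := exists_orthonormalBasis_abs_inner_le (by omega)
    (K.Q_symm hu.continuous hk y) (hu.trace_Q_mem K hk (by linarith)) hκ hA
  refine ⟨b, i, j, hij, fun x hx hxy => ?_⟩
  have hxz : x ∈ ball z 1 := by
    rw [mem_ball, dist_eq_norm]
    have := norm_sub_le_norm_sub_add_norm_sub x y z
    linarith
  have hQ := hu.norm_fderiv_sub_Q_le hbd hM hyz hy (k + 1) hxy
    (h.sum_dens_le hN hbd h0 hy hx hxy)
  rw [hu.fderiv_eq_zero hxz hx, zero_sub, norm_neg] at hQ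
  have hkey : ‖K.Q u (scale (k + 1)) y (x - y)‖ ≤ (24 * L * (V + 4 ^ N) * τ +
      32 ^ 3 * L * (V + 2 ^ N) * (densSum Ω y M (k + 1) / 2 ^ (k + 1))) * scale (k + 1) := by
    have hsq : ‖x - y‖ ^ 2 ≤ scale (k + 1) / 2 ^ (k + 1) := by
      calc ‖x - y‖ ^ 2 ≤ (4 * scale (k + 1)) ^ 2 := by gcongr
        _ = 1 / 2 * (scale (k + 1) / 2 ^ (k + 1)) := by unfold scale; field_simp; norm_num
        _ ≤ _ := by
          have : 0 ≤ scale (k + 1) / 2 ^ (k + 1) := by positivity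
          linarith
    calc _ ≤ L * (12 * (V + 4 ^ N) * (τ * scale k)) + 32 ^ 3 * L * (V + 2 ^ N) *
          (scale (k + 1) / 2 ^ (k + 1)) * densSum Ω y M (k + 1) := hQ.trans (by gcongr)
      _ = _ := by rw [← two_mul_scale_succ k]; ring
  obtain ⟨h1, h2⟩ := hb (x - y)
  have hle : 2 * N / κ * ‖K.Q u (scale (k + 1)) y (x - y)‖ ≤ _ :=
    mul_le_mul_of_nonneg_left hkey (by positivity)
  rw [← mul_assoc] at hle
  exact ⟨h1.trans hle, h2.trans hle⟩

end Tube

end Tubes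

section Decay

/-- A rate of decay starting at the index `a`. -/
def decay (a i : ℕ) : ℝ := 4 * (3 / 4) ^ (i - a)

theorem decay_pos (a i : ℕ) : 0 < decay a i := by unfold decay; positivity

theorem decay_of_le {a i : ℕ} (h : i ≤ a) : decay a i = 4 := by
  rw [decay, Nat.sub_eq_zero_of_le h, pow_zero, mul_one]

theorem decay_succ {a i : ℕ} (h : a ≤ i) : decay a (i + 1) = 3 / 4 * decay a i := by
  rw [decay, decay, Nat.succ_sub h, pow_succ]; ring

theorem decay_succ_ge (a i : ℕ) : 3 / 4 * decay a i ≤ decay a (i + 1) := by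
  rcases le_or_gt a i with h | h
  · exact (decay_succ h).ge
  · rw [decay_of_le h.le, decay_of_le h]; norm_num

theorem decay_le (a i : ℕ) : decay a i ≤ 4 := by
  rcases le_or_gt i a with h | h
  · exact (decay_of_le h).le
  · induction i, h.le using Nat.le_induction with
    | base => exact (lt_irrefl _ h).elim
    | succ i hi ih =>
      rw [decay_succ hi]
      rcases hi.eq_or_lt with rfl | hi'
      · rw [decay_of_le le_rfl]; norm_num
      · linarith [ih hi', decay_pos a i]

theorem one_le_two_pow_mul_decay (a i : ℕ) : 1 ≤ 2 ^ (i + 1) * decay a i := by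
  induction i with
  | zero => rw [decay_of_le (Nat.zero_le a)]; norm_num
  | succ i ih =>
    have := decay_succ_ge a i
    have hd := decay_pos a i
    calc (1 : ℝ) ≤ 2 ^ (i + 1) * decay a i := ih
      _ ≤ 2 ^ (i + 1) * (2 * decay a (i + 1)) := by gcongr; linarith
      _ = _ := by ring

theorem sum_two_pow_mul_decay_le (a k : ℕ) :
    ∑ i ∈ Finset.range (k + 1), 2 ^ (i + 1) * decay a i ≤ 3 * 2 ^ (k + 1) * decay a k := by
  induction k with
  | zero =>
    rw [Finset.sum_range_one, decay_of_le (Nat.zero_le a)]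
    norm_num
  | succ k ih =>
    rw [Finset.sum_range_succ]
    have := decay_succ_ge a k
    calc _ ≤ 3 * 2 ^ (k + 1) * (4 / 3 * decay a (k + 1)) + 2 ^ (k + 1 + 1) * decay a (k + 1) := by
          refine add_le_add (ih.trans ?_) le_rfl
          gcongr
          linarith
      _ = _ := by ring

/-- The last index before `k` at which a sequence starting below `κ` is below `κ`. -/
theorem exists_last_le {f : ℕ → ℝ} {κ : ℝ} (h0 : f 0 ≤ κ) (k : ℕ) :
    ∃ a n, k = a + n ∧ f a ≤ κ ∧ ∀ i, a < i → i ≤ k → κ ≤ f i := by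
  induction k with
  | zero => exact ⟨0, 0, rfl, h0, fun i h1 h2 => absurd h1 (by omega)⟩
  | succ k ih =>
    rcases le_total (f (k + 1)) κ with h | h
    · exact ⟨k + 1, 0, rfl, h, fun i h1 h2 => absurd h1 (by omega)⟩
    · obtain ⟨a, n, hk, ha, hi⟩ := ih
      refine ⟨a, n + 1, by omega, ha, fun i h1 h2 => ?_⟩
      rcases h2.eq_or_lt with rfl | h2
      · exact h
      · exact hi i h1 (by omega)

theorem norm_le_of_norm_sub_le {G : Type*} [SeminormedAddCommGroup G] {a b : G} {s t : ℝ}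
    (ha : ‖a‖ ≤ s) (h : ‖a - b‖ ≤ t) : ‖b‖ ≤ s + t :=
  (norm_le_insert a b).trans (add_le_add ha h)

end Decay

section SecondDerivatives

variable {N : ℕ} {K : DyadicKernel N} {L V : ℝ} {z y : EuclideanSpace ℝ (Fin N)} {M : ℝ}
  {Ω : Set (EuclideanSpace ℝ (Fin N))} {u : EuclideanSpace ℝ (Fin N) → ℝ}

theorem dens_two_succ_le (Ω : Set (EuclideanSpace ℝ (Fin N))) (y : EuclideanSpace ℝ (Fin N))
    (k : ℕ) : dens Ω y 2 (scale (k + 1)) ≤ 2 ^ N * dens Ω y 4 (scale k) := by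
  have hk := scale_pos (k + 1)
  calc dens Ω y 2 (scale (k + 1))
      ≤ (scale (k + 1) ^ N)⁻¹ * volume.real (Ωᶜ ∩ ball y (4 * scale k)) := by
        unfold dens
        gcongr
        · exact volume_compl_inter_ball_ne_top _ _ _
        · norm_num
        · exact scale_anti (Nat.le_succ k)
    _ = _ := by
        rw [dens, ← two_mul_scale_succ k, mul_pow, mul_inv, mul_assoc ((2 : ℝ) ^ N)⁻¹,
          mul_inv_cancel_left₀ (by positivity)]

namespace MemP

/-- As long as the second derivatives are large, the complement of `Ω` gets thinner. -/
theorem tube_decay (hN : 2 ≤ N) (h : MemP N 1 z M Ω u) (hb : K.Bounds L V) (hM : 0 ≤ M)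
    (hyz : ‖y - z‖ ≤ 3 / 4) (hy : y ∈ Ωᶜ) {κ : ℝ} (hκ : 2 ≤ κ)
    (hκN : 8 * N / 3 * (24 * L * (V + 4 ^ N) + 32 ^ 3 * L * (V + 2 ^ N) * (M + 3 * 8 ^ N)) ≤ κ)
    {a b : ℕ} (hab : ∀ i, a < i → i ≤ b → κ ≤ ‖K.Q u (scale i) y‖) (k : ℕ) (hk : k ≤ b) :
    Tube Ω y k (decay a k) := by
  have hL := hb.L_nonneg
  have hV := hb.V_nonneg
  induction k using Nat.strong_induction_on with
  | _ k ih =>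
    rcases le_or_gt k a with hka | hka
    · rw [decay_of_le hka]
      exact Tube.four hN k
    · obtain ⟨k, rfl⟩ := Nat.exists_eq_add_of_le' (show 1 ≤ k by omega)
      have hd := decay_pos a k
      have hS : densSum Ω y M (k + 1) / 2 ^ (k + 1) ≤ (M + 3 * 8 ^ N) * decay a k := by
        rw [div_le_iff₀ (by positivity), densSum]
        have h1 : M ≤ M * (2 ^ (k + 1) * decay a k) :=
          le_mul_of_one_le_right hM (one_le_two_pow_mul_decay a k)
        have h2 : ∑ i ∈ Finset.range (k + 1), 2 ^ (i + 1) * dens Ω y 4 (scale i) ≤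
            8 ^ N * (3 * 2 ^ (k + 1) * decay a k) := by
          calc _ ≤ ∑ i ∈ Finset.range (k + 1), 8 ^ N * (2 ^ (i + 1) * decay a i) := by
                refine Finset.sum_le_sum fun i hi => ?_
                rw [Finset.mem_range] at hi
                have := (ih i hi (by omega)).dens_le hN (decay_pos a i).le (decay_le a i)
                calc _ ≤ (2 : ℝ) ^ (i + 1) * (8 ^ N * decay a i) := by gcongr
                  _ = _ := by ring
            _ ≤ _ := by
                rw [← Finset.mul_sum]
                gcongr
                exact sum_two_pow_mul_decay_le a k
        linarith
      refine ((ih k (by omega) (by omega)).succ hN h hb hM hyz hy hd hκ (hab _ hka hk)).mono ?_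
      rw [decay_succ (by omega : a ≤ k)]
      calc _ ≤ 2 * N / κ * (24 * L * (V + 4 ^ N) * decay a k +
            32 ^ 3 * L * (V + 2 ^ N) * ((M + 3 * 8 ^ N) * decay a k)) := by gcongr
        _ = 8 * N / 3 * (24 * L * (V + 4 ^ N) + 32 ^ 3 * L * (V + 2 ^ N) * (M + 3 * 8 ^ N)) / κ *
            (3 / 4 * decay a k) := by field_simp; ring
        _ ≤ 1 * (3 / 4 * decay a k) := by
          gcongr
          exact div_le_one_of_le₀ hκN (by linarith)
        _ = _ := one_mul _

/-- Bound for the second derivatives at a point of the complement of `Ω`. -/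
theorem norm_Q_le_of_mem_compl (hN : 2 ≤ N) (h : MemP N 1 z M Ω u) (hb : K.Bounds L V)
    (hM : 0 ≤ M) (hyz : ‖y - z‖ ≤ 3 / 4) (hy : y ∈ Ωᶜ) {κ : ℝ} (hκ : 2 ≤ κ)
    (hκN : 8 * N / 3 * (24 * L * (V + 4 ^ N) + 32 ^ 3 * L * (V + 2 ^ N) * (M + 3 * 8 ^ N)) ≤ κ)
    (hκM : 32 ^ 2 * (L * M * V) ≤ κ) (k : ℕ) :
    ‖K.Q u (scale k) y‖ ≤ κ + 16 * (L * (2 ^ N * 8 ^ N)) := by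
  have hL := hb.L_nonneg
  have h0 : ‖K.Q u (scale 0) y‖ ≤ κ := by
    refine (hb.norm_Q_le hM 0 fun t ht => h.abs_le ?_).trans (by rw [inv_scale]; simpa using hκM)
    rw [mem_ball] at ht ⊢
    rw [scale_zero] at ht
    have := dist_triangle t y z
    rw [dist_eq_norm y z] at this
    linarith
  obtain ⟨a, n, rfl, ha, hi⟩ := exists_last_le (f := fun k => ‖K.Q u (scale k) y‖) h0 k
  have key : ∀ j ≤ n, ‖K.Q u (scale (a + j)) y‖ ≤
      κ + L * (2 ^ N * 8 ^ N) * (16 - 4 * decay a (a + j)) := by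
    intro j
    induction j with
    | zero =>
      intro _
      rw [add_zero, decay_of_le le_rfl]
      norm_num
      exact ha
    | succ j ih =>
      intro hj
      have ht := (h.tube_decay hN hb hM hyz hy hκ hκN hi (a + j) (by omega)).dens_le hN
        (decay_pos a _).le (decay_le a _)
      have hs := h.norm_Q_sub_le hb (show ‖y - z‖ < 15 / 16 by linarith) (a + j)
      refine (norm_le_of_norm_sub_le (a := K.Q u (scale (a + j)) y)
        (b := K.Q u (scale (a + j + 1)) y) (ih (by omega)) hs).trans ?_
      rw [← add_assoc, decay_succ (Nat.le_add_right a j)]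
      have hd : dens Ω y 2 (scale (a + j + 1)) ≤ 2 ^ N * (8 ^ N * decay a (a + j)) :=
        (dens_two_succ_le Ω y (a + j)).trans (by gcongr)
      have := mul_le_mul_of_nonneg_left hd hL
      linarith
  refine (key n le_rfl).trans ?_
  have : 0 ≤ L * (2 ^ N * 8 ^ N) * (4 * decay a (a + n)) := by
    have := decay_pos a (a + n)
    positivity
  linarith

end MemP

end SecondDerivatives

section Conclusion

variable {N : ℕ} {K : DyadicKernel N} {L V : ℝ} {z y : EuclideanSpace ℝ (Fin N)} {M : ℝ}
  {Ω : Set (EuclideanSpace ℝ (Fin N))} {u : EuclideanSpace ℝ (Fin N) → ℝ}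

theorem exists_scale_near {r : ℝ} (h0 : 0 < r) (h : r < 1 / 8) :
    ∃ k, 4 * scale (k + 1) ≤ r ∧ r < 4 * scale k := by
  have hex : ∃ k, 4 * scale k ≤ r := by
    have ht := ((tendsto_scale_add 0).mono_right nhdsWithin_le_nhds).eventually
      (gt_mem_nhds (show 0 < r / 4 by positivity))
    obtain ⟨k, hk⟩ := ht.exists
    exact ⟨0 + k, by linarith⟩
  classical
  have hpos : Nat.find hex ≠ 0 := fun h0 => by
    have := Nat.find_spec hex
    rw [h0, scale_zero] at this
    linarith
  obtain ⟨k, hk⟩ := Nat.exists_eq_succ_of_ne_zero hpos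
  refine ⟨k, ?_, ?_⟩
  · rw [← Nat.succ_eq_add_one, ← hk]
    exact Nat.find_spec hex
  · exact not_le.1 (Nat.find_min hex (by omega))

theorem sum_scale_le (k n : ℕ) : ∑ m ∈ Finset.range n, scale (k + 1 + m) ≤ scale k := by
  have key : ∑ m ∈ Finset.range n, scale (k + 1 + m) = scale k - scale (k + n) := by
    induction n with
    | zero => simp
    | succ n ih =>
      have := two_mul_scale_succ (k + n)
      rw [Finset.sum_range_succ, ih, show k + 1 + n = k + n + 1 by ring,
        show k + (n + 1) = k + n + 1 by ring]
      linarith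
  rw [key]
  linarith [scale_pos (k + n)]

theorem densSum_le (hb : K.Bounds L V) (k : ℕ) : densSum Ω y M k ≤ M + V * 2 ^ (k + 1) := by
  have hV := hb.V_nonneg
  induction k with
  | zero =>
    rw [densSum, Finset.range_zero, Finset.sum_empty, add_zero]
    exact le_add_of_nonneg_right (by positivity)
  | succ k ih =>
    have hd : dens Ω y 4 (scale k) ≤ V := dens_le hb y (scale_pos k) (by norm_num)
    have := mul_le_mul_of_nonneg_left hd (show (0 : ℝ) ≤ 2 ^ (k + 1) by positivity)
    rw [densSum] at ih ⊢
    rw [Finset.sum_range_succ, pow_succ _ (k + 1)]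
    linarith

namespace MemP

/-- Linear growth of the gradient away from the complement of `Ω`. -/
theorem norm_fderiv_le (h : MemP N 1 z M Ω u) (hb : K.Bounds L V) (hM : 0 ≤ M)
    (hyz : ‖y - z‖ ≤ 3 / 4) (hy : y ∈ Ωᶜ) {G : ℝ} (hG : ∀ k, ‖K.Q u (scale k) y‖ ≤ G)
    {x : EuclideanSpace ℝ (Fin N)} (hx : ‖x - y‖ < 1 / 8) :
    ‖fderiv ℝ u x‖ ≤ (G + L * V + 32 ^ 3 * L * (V + 2 ^ N) * (M + V)) * ‖x - y‖ := by
  have hL := hb.L_nonneg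
  have hV := hb.V_nonneg
  rcases (norm_nonneg (x - y)).eq_or_lt with h0 | h0
  · rw [← h0, mul_zero, sub_eq_zero.1 (norm_eq_zero.1 h0.symm),
      h.fderiv_eq_zero (by rw [mem_ball, dist_eq_norm]; linarith) hy, norm_zero]
  obtain ⟨k, hk1, hk2⟩ := exists_scale_near h0 hx
  have h2k := two_mul_scale_succ k
  have hB : ∀ n, ∑ m ∈ Finset.range n, scale (k + 1 + m) *
      (dens Ω x 2 (scale (k + 1 + m)) + dens Ω y 2 (scale (k + 1 + m))) ≤ ‖x - y‖ * V := by
    intro n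
    calc _ ≤ ∑ m ∈ Finset.range n, scale (k + 1 + m) * (2 * V) := by
          refine Finset.sum_le_sum fun m _ => ?_
          have hp := scale_pos (k + 1 + m)
          have h1 : dens Ω x 2 (scale (k + 1 + m)) ≤ V := dens_le hb x hp (by norm_num)
          have h2 : dens Ω y 2 (scale (k + 1 + m)) ≤ V := dens_le hb y hp (by norm_num)
          gcongr
          linarith
      _ ≤ scale k * (2 * V) := by
          rw [← Finset.sum_mul]
          gcongr
          exact sum_scale_le k n
      _ = (4 * scale (k + 1)) * V := by rw [← h2k]; ring
      _ ≤ _ := by gcongr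
  have hE := h.norm_fderiv_sub_Q_le hb hM hyz hy k hk2 hB
  have hS : ‖x - y‖ * densSum Ω y M k ≤ M + V := by
    have hr : ‖x - y‖ * 2 ^ (k + 1) ≤ 1 := by
      calc _ ≤ (4 * scale k) * 2 ^ (k + 1) := by gcongr
        _ = 1 / 4 := by unfold scale; rw [pow_succ]; field_simp; norm_num
        _ ≤ 1 := by norm_num
    calc _ ≤ ‖x - y‖ * (M + V * 2 ^ (k + 1)) := by gcongr; exact densSum_le hb k
      _ = ‖x - y‖ * M + V * (‖x - y‖ * 2 ^ (k + 1)) := by ring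
      _ ≤ 1 * M + V * 1 := by gcongr; linarith
      _ = _ := by ring
  have hA : ‖K.Q u (scale k) y (x - y)‖ ≤ G * ‖x - y‖ :=
    (ContinuousLinearMap.le_opNorm _ _).trans (by gcongr; exact hG k)
  have hC := mul_le_mul_of_nonneg_left hS
    (show 0 ≤ 32 ^ 3 * L * (V + 2 ^ N) * ‖x - y‖ by positivity)
  have := norm_le_norm_sub_add (fderiv ℝ u x) (K.Q u (scale k) y (x - y))
  linarith

/-- Quadratic growth away from the complement of `Ω`. -/
theorem abs_le_mul_sq (h : MemP N 1 z M Ω u) (hyz : ‖y - z‖ ≤ 3 / 4) (hy : y ∈ Ωᶜ) {C : ℝ}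
    (hC0 : 0 ≤ C) (hC : ∀ x, ‖x - y‖ < 1 / 8 → ‖fderiv ℝ u x‖ ≤ C * ‖x - y‖)
    {x : EuclideanSpace ℝ (Fin N)} (hx : ‖x - y‖ < 1 / 8) : |u x| ≤ C * ‖x - y‖ ^ 2 := by
  have hd := Convex.norm_image_sub_le_of_norm_fderiv_le (𝕜 := ℝ) (f := u)
    (s := closedBall y ‖x - y‖) (C := C * ‖x - y‖) (x := y) (y := x)
    (fun t _ => (h.contDiff.differentiable (by simp)) t) (fun t ht => ?_)
    (convex_closedBall _ _) (mem_closedBall_self (norm_nonneg _)) (mem_closedBall_iff_norm.2 le_rfl)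
  · rw [h.eq_zero (by rw [mem_ball, dist_eq_norm]; linarith) hy, sub_zero, Real.norm_eq_abs] at hd
    exact hd.trans (le_of_eq (by ring))
  · have ht' := mem_closedBall_iff_norm.1 ht
    exact (hC t (ht'.trans_lt hx)).trans (by gcongr)

/-- Bound for the second derivatives in the half ball. -/
theorem norm_Q_le_of_mem_ball (h : MemP N 1 z M Ω u) (hb : K.Bounds L V) (hM : 0 ≤ M) {C : ℝ}
    (hC0 : 0 ≤ C) (hC : ∀ y ∈ Ωᶜ, ‖y - z‖ ≤ 3 / 4 → ∀ x, ‖x - y‖ < 1 / 8 →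
      |u x| ≤ C * ‖x - y‖ ^ 2)
    {x : EuclideanSpace ℝ (Fin N)} (hx : x ∈ ball z (1 / 2)) (n : ℕ) :
    ‖K.Q u (scale n) x‖ ≤ 16 * (L * C * V) + 32 ^ 2 * (L * M * V) := by
  have hL := hb.L_nonneg
  have hV := hb.V_nonneg
  rw [mem_ball, dist_eq_norm] at hx
  induction n with
  | zero =>
    refine (hb.norm_Q_le hM 0 fun t ht => h.abs_le ?_).trans ?_
    · rw [mem_ball] at ht ⊢
      rw [scale_zero] at ht
      have := dist_triangle t x z
      rw [dist_eq_norm x z] at this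
      linarith
    · rw [inv_scale, pow_zero, mul_one]
      exact le_add_of_nonneg_left (by positivity)
  | succ n ih =>
    have hn := scale_pos (n + 1)
    rcases (Ωᶜ ∩ ball x (2 * scale (n + 1))).eq_empty_or_nonempty with he | ⟨y, hy, hyx⟩
    · have hs := h.norm_Q_sub_le hb (show ‖x - z‖ < 15 / 16 by linarith) n
      rw [dens, he, measureReal_empty, mul_zero, mul_zero] at hs
      exact (norm_le_of_norm_sub_le (a := K.Q u (scale n) x) (b := K.Q u (scale (n + 1)) x)
        ih hs).trans (add_zero _).le
    · have hs := scale_le (n + 1)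
      rw [mem_ball, dist_eq_norm] at hyx
      have hyz : ‖y - z‖ ≤ 3 / 4 := by
        have := norm_sub_le_norm_sub_add_norm_sub y x z
        linarith
      refine (hb.norm_Q_le (m := C * (4 * scale (n + 1)) ^ 2) (by positivity) (n + 1)
        fun t ht => ?_).trans ?_
      · rw [mem_ball, dist_eq_norm] at ht
        have hty : ‖t - y‖ < 4 * scale (n + 1) := by
          have := norm_sub_le_norm_sub_add_norm_sub t x y
          rw [norm_sub_rev x y] at this
          linarith
        exact (hC y hy hyz t (by linarith)).trans (by gcongr)
      · calc _ = 16 * (L * C * V) := by field_simp; norm_num; ring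
          _ ≤ _ := le_add_of_nonneg_right (by positivity)

/-- Bounds on the regularized second derivatives pass to a Lipschitz bound for the derivative. -/
theorem norm_fderiv_sub_le (h : MemP N 1 z M Ω u) {C : ℝ}
    (hC : ∀ x ∈ ball z (1 / 2), ∀ n, ‖K.Q u (scale n) x‖ ≤ C) {x y : EuclideanSpace ℝ (Fin N)}
    (hx : x ∈ ball z (1 / 2)) (hy : y ∈ ball z (1 / 2)) :
    ‖fderiv ℝ u x - fderiv ℝ u y‖ ≤ C * ‖x - y‖ := by
  have hP : ∀ n, ‖K.P u (scale (0 + n)) x - K.P u (scale (0 + n)) y‖ ≤ C * ‖x - y‖ := fun n =>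
    (convex_ball z (1 / 2)).norm_image_sub_le_of_norm_hasFDerivWithin_le
      (fun t _ => (K.hasFDerivAt_P h.continuous (scale_pos _) t).hasFDerivWithinAt)
      (fun t ht => hC t ht _) hy hx
  refine ContinuousLinearMap.opNorm_le_bound _ ((norm_nonneg _).trans (hP 0)) fun v => ?_
  refine le_of_tendsto ((K.tendsto_P_apply h.contDiff 0 x v).sub
    (K.tendsto_P_apply h.contDiff 0 y v)).norm (Eventually.of_forall fun n => ?_)
  exact ((K.P u (scale (0 + n)) x - K.P u (scale (0 + n)) y).le_opNorm v).trans
    (by gcongr; exact hP n)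

end MemP

end Conclusion

/-- uniform interior `C^{1,1}` estimate for the class `P₁(z, M)`. -/
theorem interior_C11_estimate (N : ℕ) (hN : 2 ≤ N) :
    ∃ C₁ : ℝ, 0 < C₁ ∧
      ∀ (M : ℝ), 0 < M →
        ∀ (Ω : Set (EuclideanSpace ℝ (Fin N))) (z : EuclideanSpace ℝ (Fin N))
          (u : EuclideanSpace ℝ (Fin N) → ℝ),
          MemP N 1 z M Ω u →
            LipschitzOnWith (Real.toNNReal (C₁ * M)) (gradient u) (ball z (1 / 2)) := by
  obtain ⟨K⟩ := nonempty_dyadicKernel N (by omega)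
  obtain ⟨L, V, hb⟩ := K.exists_bounds
  have hL := hb.L_nonneg
  have hV := hb.V_nonneg
  have hI := K.integral_Ψ_pos
  set I := ∫ y, K.Ψ y
  set c := 32 ^ 3 * L * (V + 2 ^ N) with hc
  have hc0 : 0 ≤ c := by positivity
  set e := 8 * (N : ℝ) / 3 * (24 * L * (V + 4 ^ N) + c * (1 + 3 * 8 ^ N)) with he
  have he0 : 0 ≤ e := by positivity
  set D := 2 + e + 32 ^ 2 * (L * V) with hD
  set D₃ := D + 16 * (L * (2 ^ N * 8 ^ N)) + L * V + c * (1 + V) with hD₃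
  have hD₃0 : 0 ≤ D₃ := by positivity
  set D₄ := 16 * (L * D₃ * V) + 32 ^ 2 * (L * V) with hD₄
  have hD₄0 : 0 ≤ D₄ := by positivity
  refine ⟨D₄ * (512 / I + 1) + 1, by positivity, fun M hM Ω z u h => ?_⟩
  have hLV : 0 ≤ L * V := by positivity
  have h8 : (0 : ℝ) < 8 ^ N := by positivity
  have hQ : ∀ y ∈ Ωᶜ, ‖y - z‖ ≤ 3 / 4 → ∀ k, ‖K.Q u (scale k) y‖ ≤
      D * (M + 1) + 16 * (L * (2 ^ N * 8 ^ N)) := fun y hy hyz k => by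
    refine h.norm_Q_le_of_mem_compl hN hb hM.le hyz hy ?_ ?_ ?_ k
    · nlinarith
    · calc _ ≤ 8 * (N : ℝ) / 3 * (24 * L * (V + 4 ^ N) * (M + 1) +
            c * ((1 + 3 * 8 ^ N) * (M + 1))) := by
            refine mul_le_mul_of_nonneg_left (add_le_add ?_ ?_) (by positivity)
            · exact le_mul_of_one_le_right (by positivity) (by linarith)
            · exact mul_le_mul_of_nonneg_left (by nlinarith) hc0
        _ = e * (M + 1) := by ring
        _ ≤ D * (M + 1) := by gcongr; linarith
    · nlinarith
  have hu : ∀ y ∈ Ωᶜ, ‖y - z‖ ≤ 3 / 4 → ∀ x, ‖x - y‖ < 1 / 8 →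
      |u x| ≤ D₃ * (M + 1) * ‖x - y‖ ^ 2 := fun y hy hyz x hx => by
    refine h.abs_le_mul_sq hyz hy (by positivity) (fun t ht => ?_) hx
    refine (h.norm_fderiv_le hb hM.le hyz hy (hQ y hy hyz) ht).trans ?_
    gcongr
    have h1 : 0 ≤ L * (2 ^ N * 8 ^ N) := by positivity
    have h2 : 0 ≤ c * V := by positivity
    nlinarith
  have hM1 : M + 1 ≤ (512 / I + 1) * M := by
    have := h.integral_Ψ_le K
    have h1 : 1 ≤ 512 / I * M := by
      rw [div_mul_eq_mul_div, one_le_div hI]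
      linarith
    linarith
  have hQ₂ : ∀ x ∈ ball z (1 / 2), ∀ n, ‖K.Q u (scale n) x‖ ≤
      (D₄ * (512 / I + 1) + 1) * M := fun x hx n => by
    refine (h.norm_Q_le_of_mem_ball hb hM.le (by positivity) hu hx n).trans ?_
    calc _ ≤ D₄ * (M + 1) := by rw [hD₄]; nlinarith
      _ ≤ D₄ * ((512 / I + 1) * M) := by gcongr
      _ ≤ _ := by linarith
  refine LipschitzOnWith.of_dist_le_mul fun x hx y hy => ?_
  rw [Real.coe_toNNReal _ (by positivity), dist_eq_norm, dist_eq_norm, gradient, gradient,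
    ← map_sub, LinearIsometryEquiv.norm_map]
  exact h.norm_fderiv_sub_le hQ₂ hx hy
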